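/- arXiv:2510.00888 — 6 statements merged into one kernel-verified Lean document; each statement's English description precedes it below -/
import Mathlib

section
/- Let n, p, q be integers with 1 ≤ p < n, q < n and n = p + q. Then there exists a constant C > 0 depending only on n, p, q such that for every ρ ≥ 1 and every ξ ∈ ℝⁿ with |ξ| ≤ ρ one has ∫_{B(0,ρ)} (1+|z|)^{q−n} |ξ−z|^{p−n} dz ≤ C · ln(2+ρ). -/
open MeasureTheory Metric

theorem pw (p q : ℕ) (a b : ℝ) (ha : 1 ≤ a) (hb : 0 < b) :
    (a^p)⁻¹ * (b^q)⁻¹ ≤ (a^(p+q))⁻¹ + (2^(p+q) * ((1+b)^(p+q))⁻¹ + (Set.Iio (1:ℝ)).indicator (fun y => (y^q)⁻¹) b) := by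
  have h1 : 0 ≤ (a^(p+q))⁻¹ := by positivity
  have h2 : 0 ≤ 2^(p+q) * ((1+b)^(p+q))⁻¹ := by positivity
  have h3 : 0 ≤ (Set.Iio (1:ℝ)).indicator (fun y => (y^q)⁻¹) b := by
    by_cases hb1 : b < 1
    · rw [Set.indicator_of_mem (by exact hb1)]; positivity
    · rw [Set.indicator_of_notMem (by simpa using hb1)]
  by_cases hb1 : b < 1
  · rw [Set.indicator_of_mem (by exact hb1)] at *
    have : (a^p)⁻¹ ≤ 1 := inv_le_one_of_one_le₀ (one_le_pow₀ ha)
    have : (a^p)⁻¹ * (b^q)⁻¹ ≤ 1 * (b^q)⁻¹ := by gcongr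
    linarith
  · push Not at hb1
    by_cases hab : a ≤ b
    · have : (a^p)⁻¹ * (b^q)⁻¹ ≤ (a^p)⁻¹ * (a^q)⁻¹ := by gcongr
      rw [← mul_inv (a^p) (a^q), ← pow_add] at this
      linarith
    · push Not at hab
      have e : (a^p)⁻¹ * (b^q)⁻¹ ≤ (b^p)⁻¹ * (b^q)⁻¹ := by gcongr
      have : (b^p)⁻¹ * (b^q)⁻¹ ≤ 2^(p+q) * ((1+b)^(p+q))⁻¹ := by
        rw [← mul_inv, ← pow_add, ← div_eq_mul_inv, inv_eq_one_div, div_le_div_iff₀ (by positivity) (by positivity), one_mul, ← mul_pow]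
        gcongr
        linarith
      linarith

theorem bd (n : ℕ) (hn : 1 ≤ n) : ∃ K : ℝ, 0 < K ∧ ∀ r : ℝ, 0 ≤ r → 
   Integrable (fun z : EuclideanSpace ℝ (Fin n) => (Set.Iio r).indicator (fun y => ((1+y)^n)⁻¹) ‖z‖) ∧
    ∫ z : EuclideanSpace ℝ (Fin n), (Set.Iio r).indicator (fun y => ((1+y)^n)⁻¹) ‖z‖ ≤ K * Real.log (1 + r) := by
  have : Nonempty (Fin n) := ⟨⟨0, hn⟩⟩
  refine ⟨n * volume.real (ball (0:EuclideanSpace ℝ (Fin n)) 1), ?_, fun r hr => ?_⟩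
  · have : 0 < volume.real (ball (0:EuclideanSpace ℝ (Fin n)) 1) :=
      ENNReal.toReal_pos (measure_ball_pos _ _ one_pos).ne' measure_ball_lt_top.ne
    positivity
  have hg : IntegrableOn (fun y : ℝ => (1+y)⁻¹) (Set.Ioo 0 r) := by
    refine (ContinuousOn.integrableOn_Icc ?_).mono_set Set.Ioo_subset_Icc_self
    exact ContinuousOn.inv₀ (by fun_prop) (fun y hy => by have := hy.1; positivity)
  have hle : ∀ y ∈ Set.Ioo 0 r, y^(n-1) * ((1+y)^n)⁻¹ ≤ (1+y)⁻¹ := by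
    intro y hy
    have := hy.1
    rw [← div_eq_mul_inv, inv_eq_one_div, div_le_div_iff₀ (by positivity) (by positivity), one_mul]
    calc y^(n-1)*(1+y) ≤ (1+y)^(n-1)*(1+y) := by gcongr; linarith
      _ = _ := by rw [← pow_succ, Nat.sub_add_cancel hn]
  have hf : IntegrableOn (fun y : ℝ => y^(n-1) * ((1+y)^n)⁻¹) (Set.Ioo 0 r) := by
    refine hg.mono' (Measurable.aestronglyMeasurable (by fun_prop)) ?_
    filter_upwards [ae_restrict_mem measurableSet_Ioo] with y hy
    have := hy.1
    rw [Real.norm_of_nonneg (by positivity)]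
    exact hle y hy
  have he : (fun y : ℝ => y^(n-1) • (Set.Iio r).indicator (fun y => ((1+y)^n)⁻¹) y) = (Set.Iio r).indicator (fun y => y^(n-1) * ((1+y)^n)⁻¹) := by
    ext y; by_cases hy : y < r <;> simp [Set.indicator, hy]
  constructor
  · rw [integrable_fun_norm_addHaar volume (f := (Set.Iio r).indicator (fun y => ((1+y)^n)⁻¹)), finrank_euclideanSpace_fin, he]
    rw [IntegrableOn, integrable_indicator_iff measurableSet_Iio, IntegrableOn, Measure.restrict_restrict measurableSet_Iio, Set.Iio_inter_Ioi]
    exact hf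
  · rw [integral_fun_norm_addHaar volume (f := (Set.Iio r).indicator (fun y => ((1+y)^n)⁻¹)), finrank_euclideanSpace_fin, he, setIntegral_indicator measurableSet_Iio, Set.Ioi_inter_Iio, smul_eq_mul, nsmul_eq_mul, ← mul_assoc]
    gcongr
    calc _ ≤ ∫ y in Set.Ioo 0 r, (1+y)⁻¹ := setIntegral_mono_on hf hg measurableSet_Ioo hle
      _ = Real.log (1+r) := by
        rw [← integral_Ioc_eq_integral_Ioo, ← intervalIntegral.integral_of_le hr]
        rw [intervalIntegral.integral_comp_add_left (fun y => y⁻¹), integral_inv_of_pos (by linarith) (by linarith)]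
        simp

theorem bd2 (n q : ℕ) (hq : q < n) : 
   Integrable (fun z : EuclideanSpace ℝ (Fin n) => (Set.Iio (1:ℝ)).indicator (fun y => (y^q)⁻¹) ‖z‖) := by
  have : Nonempty (Fin n) := ⟨⟨0, by omega⟩⟩
  rw [integrable_fun_norm_addHaar volume (f := (Set.Iio (1:ℝ)).indicator (fun y => (y^q)⁻¹)), finrank_euclideanSpace_fin]
  have he : (fun y : ℝ => y^(n-1) • (Set.Iio (1:ℝ)).indicator (fun y => (y^q)⁻¹) y) = (Set.Iio (1:ℝ)).indicator (fun y => y^(n-1) * (y^q)⁻¹) := by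
    ext y; by_cases hy : y < 1 <;> simp [Set.indicator, hy]
  rw [he, IntegrableOn, integrable_indicator_iff measurableSet_Iio, IntegrableOn, Measure.restrict_restrict measurableSet_Iio, Set.Iio_inter_Ioi]
  have hg : IntegrableOn (fun y : ℝ => (1:ℝ)) (Set.Ioo 0 1) := by simp
  refine hg.mono' (Measurable.aestronglyMeasurable (by fun_prop)) ?_
  filter_upwards [ae_restrict_mem measurableSet_Ioo] with y hy
  have := hy.1
  rw [Real.norm_of_nonneg (by positivity), ← div_eq_mul_inv]
  exact div_le_one_of_le₀ (pow_le_pow_of_le_one hy.1.le hy.2.le (by omega)) (by positivity)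

/-- Giraud-type lemma, case `n = p + q`. -/
theorem giraud_critical (n : ℕ) (p q : ℤ)
    (hp : 1 ≤ p) (hpn : p < (n : ℤ)) (hq : q < (n : ℤ)) (h : (n : ℤ) = p + q) :
    ∃ C : ℝ, 0 < C ∧ ∀ ρ : ℝ, 1 ≤ ρ → ∀ ξ : EuclideanSpace ℝ (Fin n), ‖ξ‖ ≤ ρ →
      (∫ z in ball (0 : EuclideanSpace ℝ (Fin n)) ρ,
          (1 + ‖z‖) ^ (q - (n : ℤ)) * ‖ξ - z‖ ^ (p - (n : ℤ)))
        ≤ C * Real.log (2 + ρ) := by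
  have e1 : q - (n:ℤ) = -p := by omega
  have e2 : p - (n:ℤ) = -q := by omega
  rw [e1, e2]
  lift p to ℕ using by omega
  lift q to ℕ using by omega
  have hn : n = p + q := by omega
  have : Nonempty (Fin n) := ⟨⟨0, by omega⟩⟩
  obtain ⟨K, hK, hb⟩ := bd n (by omega)
  have hi2 := bd2 n q (by omega)
  set M := ∫ z : EuclideanSpace ℝ (Fin n), (Set.Iio (1:ℝ)).indicator (fun y => (y^q)⁻¹) ‖z‖ with hM
  have hM0 : 0 ≤ M := integral_nonneg fun z => Set.indicator_apply_nonneg (fun _ => by positivity)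
  refine ⟨K + 2^n * (K * 2) + M, by positivity, fun ρ hρ ξ hξ => ?_⟩
  obtain ⟨i1, b1⟩ := hb ρ (by linarith)
  obtain ⟨i3, b3⟩ := hb (2*ρ) (by linarith)
  set f := (Set.Iio ρ).indicator (fun y : ℝ => ((1+y)^n)⁻¹) with hf
  set g := (Set.Iio (2*ρ)).indicator (fun y : ℝ => ((1+y)^n)⁻¹) with hg
  set k := (Set.Iio (1:ℝ)).indicator (fun y : ℝ => (y^q)⁻¹) with hk
  have j3 := i3.comp_sub_left ξ
  have j2 := hi2.comp_sub_left ξ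
  have s3 := integral_sub_left_eq_self (fun z => g ‖z‖) volume ξ
  have s2 := integral_sub_left_eq_self (fun z => k ‖z‖) volume ξ
  rw [← integral_indicator measurableSet_ball]
  have l1 : Real.log (1+ρ) ≤ Real.log (2+ρ) := Real.log_le_log (by linarith) (by linarith)
  have l2 : Real.log (1+2*ρ) ≤ 2 * Real.log (2+ρ) := by
    rw [← Real.log_rpow (by linarith)]
    apply Real.log_le_log (by linarith)
    norm_num
    nlinarith
  have l3 : 1 ≤ Real.log (2+ρ) := by
    rw [Real.le_log_iff_exp_le (by linarith)]
    linarith [Real.exp_one_lt_d9]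
  calc _ ≤ ∫ z, (f ‖z‖ + (2^n * g ‖ξ - z‖ + k ‖ξ - z‖)) := by
        apply integral_mono_of_nonneg
        · exact Filter.Eventually.of_forall fun z => Set.indicator_apply_nonneg (fun _ => by positivity)
        · exact i1.add ((j3.const_mul _).add j2)
        · have : ∀ᵐ z : EuclideanSpace ℝ (Fin n), z ≠ ξ := by
            simp [ae_iff]
          filter_upwards [this] with z hz
          have hpos : 0 < ‖ξ - z‖ := norm_pos_iff.2 (sub_ne_zero.2 hz.symm)
          by_cases hzρ : z ∈ ball 0 ρ
          · have hz' : ‖z‖ < ρ := by simpa using hzρ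
            have hz2 : ‖ξ - z‖ < 2*ρ := by linarith [norm_sub_le ξ z]
            rw [Set.indicator_of_mem hzρ, hf, hg, Set.indicator_of_mem (by exact hz'), Set.indicator_of_mem (by exact hz2)]
            simp only [zpow_neg, zpow_natCast, hn]
            exact pw p q _ _ (by linarith [norm_nonneg z]) hpos
          · rw [Set.indicator_of_notMem hzρ]
            have a1 : 0 ≤ f ‖z‖ := Set.indicator_apply_nonneg (fun _ => by positivity)
            have a2 : 0 ≤ g ‖ξ - z‖ := Set.indicator_apply_nonneg (fun _ => by positivity)
            have a3 : 0 ≤ k ‖ξ - z‖ := Set.indicator_apply_nonneg (fun _ => by positivity)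
            positivity
    _ = (∫ z : EuclideanSpace ℝ (Fin n), f ‖z‖) + (2^n * (∫ z : EuclideanSpace ℝ (Fin n), g ‖z‖) + M) := by
        have j4 : Integrable (fun z => 2^n * g ‖ξ - z‖ + k ‖ξ - z‖) := (j3.const_mul _).add j2
        rw [integral_add i1 j4, integral_add (j3.const_mul _) j2, integral_const_mul, s3, s2]
    _ ≤ K * Real.log (2+ρ) + (2^n * (K * (2 * Real.log (2+ρ))) + M * Real.log (2+ρ)) := by
        gcongr
        · exact b1.trans (by gcongr)
        · exact b3.trans (by gcongr)
        · exact le_mul_of_one_le_right hM0 l3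
    _ = _ := by ring
end

section
/- Let n, p, q be integers with 1 ≤ p < n, q < n and n > p + q. Then there exists a constant C > 0 depending only on n, p, q such that for every ρ ≥ 1 and every ξ ∈ ℝⁿ with |ξ| ≤ ρ one has: ∫_{B(0,ρ)} (1+|z|)^{q−n} |ξ−z|^{p−n} dz ≤ C·(1+|ξ|)^{p+q−n} if q > 0; ∫_{B(0,ρ)} (1+|z|)^{q−n} |ξ−z|^{p−n} dz ≤ C·(1+|ξ|)^{p−n}·ln(2+|ξ|) if q = 0; and ∫_{B(0,ρ)} (1+|z|)^{q−n} |ξ−z|^{p−n} dz ≤ C·(1+|ξ|)^{p−n} if q < 0. -/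
open MeasureTheory Metric

lemma gs_rad (n : ℕ) (hn : 1 ≤ n) (S : Set ℝ) (hS : MeasurableSet S) (φ ψ : ℝ → ℝ)
    (hφm : Measurable φ) (hψ : IntegrableOn ψ (Set.Ioi 0 ∩ S))
    (h0 : ∀ r, 0 < r → r ∈ S → 0 ≤ φ r)
    (hle : ∀ r, 0 < r → r ∈ S → r ^ (n - 1) * φ r ≤ ψ r) :
    Integrable (fun x : EuclideanSpace ℝ (Fin n) => S.indicator φ ‖x‖) ∧
    ∫ x : EuclideanSpace ℝ (Fin n), S.indicator φ ‖x‖ ≤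
      (n * volume.real (ball (0 : EuclideanSpace ℝ (Fin n)) 1)) * ∫ r in Set.Ioi 0 ∩ S, ψ r := by
  have : Nonempty (Fin n) := ⟨⟨0, hn⟩⟩
  have : Nontrivial (EuclideanSpace ℝ (Fin n)) := by
    apply Module.nontrivial_of_finrank_pos (R := ℝ)
    simp; omega
  have hind : IntegrableOn (S.indicator ψ) (Set.Ioi 0) := by
    rw [IntegrableOn, integrable_indicator_iff hS, IntegrableOn, Measure.restrict_restrict hS, Set.inter_comm]
    exact hψ
  have hbd : ∀ r ∈ Set.Ioi (0:ℝ), 0 ≤ r ^ (n - 1) • S.indicator φ r ∧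
      r ^ (n - 1) • S.indicator φ r ≤ S.indicator ψ r := by
    intro r hr
    have hr' : (0:ℝ) < r := hr
    by_cases hrS : r ∈ S
    · simp only [Set.indicator_of_mem hrS, smul_eq_mul]
      exact ⟨mul_nonneg (by positivity) (h0 r hr hrS), hle r hr hrS⟩
    · simp [hrS]
  have hint : IntegrableOn (fun r : ℝ => r ^ (n - 1) • S.indicator φ r) (Set.Ioi 0) := by
    refine Integrable.mono' hind ?_ ?_
    · exact ((measurable_id.pow_const _).smul (hφm.indicator hS)).aestronglyMeasurable
    · filter_upwards [ae_restrict_mem measurableSet_Ioi] with r hr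
      rw [Real.norm_of_nonneg (hbd r hr).1]
      exact (hbd r hr).2
  constructor
  · rw [integrable_fun_norm_addHaar (volume : Measure (EuclideanSpace ℝ (Fin n)))]
    simpa using hint
  · rw [integral_fun_norm_addHaar (volume : Measure (EuclideanSpace ℝ (Fin n)))]
    simp only [finrank_euclideanSpace_fin, nsmul_eq_mul]
    rw [smul_eq_mul, ← mul_assoc]
    refine mul_le_mul_of_nonneg_left ?_ (by positivity)
    have : ∫ r in Set.Ioi 0 ∩ S, ψ r = ∫ r in Set.Ioi 0, S.indicator ψ r := by
      rw [setIntegral_indicator hS]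
    rw [this]
    exact setIntegral_mono_on hint hind measurableSet_Ioi fun r hr => (hbd r hr).2

lemma gs_anti {x y : ℝ} {m : ℤ} (hx : 0 < x) (hxy : x ≤ y) (hm : m ≤ 0) : y ^ m ≤ x ^ m := by
  have hy := hx.trans_le hxy
  have := zpow_le_zpow_left₀ (n := -m) (by omega) hx.le hxy
  rw [zpow_neg, zpow_neg] at this
  exact (inv_le_inv₀ (by positivity) (by positivity)).1 this

lemma gs_A (n : ℕ) (p : ℤ) (hn : 1 ≤ n) (hp : 1 ≤ p) (T : ℝ) (hT : 0 < T) :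
    Integrable (fun x : EuclideanSpace ℝ (Fin n) =>
      (Set.Iic T).indicator (fun r : ℝ => r ^ (p - (n:ℤ))) ‖x‖) ∧
    ∫ x : EuclideanSpace ℝ (Fin n), (Set.Iic T).indicator (fun r : ℝ => r ^ (p - (n:ℤ))) ‖x‖ ≤
      (n * volume.real (ball (0 : EuclideanSpace ℝ (Fin n)) 1)) * (T ^ p / p) := by
  have hI : ∫ r in Set.Ioi 0 ∩ Set.Iic T, r ^ (p - 1) = T ^ p / p := by
    rw [Set.Ioi_inter_Iic, ← intervalIntegral.integral_of_le hT.le, integral_zpow (Or.inl (by omega))]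
    simp [zero_zpow p (by omega)]
  rw [← hI]
  refine gs_rad n hn _ measurableSet_Iic _ _ (by fun_prop) ?_ (fun r hr _ => by positivity) ?_
  · rw [Set.Ioi_inter_Iic, ← intervalIntegrable_iff_integrableOn_Ioc_of_le hT.le]
    exact intervalIntegral.intervalIntegrable_zpow (Or.inl (by omega))
  · intro r hr _
    rw [← zpow_natCast, ← zpow_add₀ hr.ne']
    apply le_of_eq; congr 1; push_cast [hn]; ring

lemma gs_B (n : ℕ) (q : ℤ) (hn : 1 ≤ n) (T : ℝ) (hT : 0 < T) :
    Integrable (fun x : EuclideanSpace ℝ (Fin n) =>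
      (Set.Iic T).indicator (fun r : ℝ => (1 + r) ^ (q - (n:ℤ))) ‖x‖) ∧
    ∫ x : EuclideanSpace ℝ (Fin n), (Set.Iic T).indicator (fun r : ℝ => (1 + r) ^ (q - (n:ℤ))) ‖x‖ ≤
      (n * volume.real (ball (0 : EuclideanSpace ℝ (Fin n)) 1)) * 
        ∫ r in (1:ℝ)..(1+T), r ^ (q - 1) := by
  have hI : ∫ r in Set.Ioi 0 ∩ Set.Iic T, (1 + r) ^ (q - 1) = ∫ r in (1:ℝ)..(1+T), r ^ (q - 1) := by
    rw [Set.Ioi_inter_Iic, ← intervalIntegral.integral_of_le hT.le]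
    simpa using intervalIntegral.integral_comp_add_left (a := 0) (b := T) (fun r : ℝ => r ^ (q - 1)) 1
  rw [← hI]
  refine gs_rad n hn _ measurableSet_Iic _ _ (by fun_prop) ?_ (fun r hr _ => by positivity) ?_
  · rw [Set.Ioi_inter_Iic]
    refine IntegrableOn.mono_set ?_ Set.Ioc_subset_Icc_self
    refine ContinuousOn.integrableOn_Icc ?_
    refine ContinuousOn.zpow₀ (by fun_prop) _ ?_
    intro r hr; left; linarith [hr.1]
  · intro r hr _
    calc r ^ (n - 1) * (1 + r) ^ (q - (n:ℤ)) ≤ (1 + r) ^ (n - 1) * (1 + r) ^ (q - (n:ℤ)) := by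
          gcongr; linarith
      _ = _ := by
        rw [← zpow_natCast, ← zpow_add₀ (by linarith)]
        congr 1; push_cast [hn]; ring

lemma gs_C (n : ℕ) (s : ℤ) (hn : 1 ≤ n) (hs : s < 0) (T : ℝ) (hT : 0 < T) :
    Integrable (fun x : EuclideanSpace ℝ (Fin n) =>
      (Set.Ioi T).indicator (fun r : ℝ => r ^ (s - (n:ℤ))) ‖x‖) ∧
    ∫ x : EuclideanSpace ℝ (Fin n), (Set.Ioi T).indicator (fun r : ℝ => r ^ (s - (n:ℤ))) ‖x‖ ≤
      (n * volume.real (ball (0 : EuclideanSpace ℝ (Fin n)) 1)) * (T ^ s / (-s)) := by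
  have hs1 : ((s:ℝ) - 1) < -1 := by
    have : (s:ℝ) < 0 := by exact_mod_cast hs
    linarith
  have hE : ∀ x : ℝ, x ^ ((s:ℝ) - 1) = x ^ (s - 1) := fun x => by
    rw [← Real.rpow_intCast]; push_cast; rfl
  have hset : Set.Ioi 0 ∩ Set.Ioi T = Set.Ioi T := by
    rw [Set.Ioi_inter_Ioi, sup_of_le_right hT.le]
  have hI : ∫ r in Set.Ioi 0 ∩ Set.Ioi T, r ^ (s - 1) = T ^ s / (-s) := by
    have := integral_Ioi_rpow_of_lt hs1 hT
    simp only [hE] at this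
    rw [hset, this]
    simp [neg_div, div_neg]
  rw [← hI]
  refine gs_rad n hn _ measurableSet_Ioi _ _ (by fun_prop) ?_ (fun r hr _ => by positivity) ?_
  · have := integrableOn_Ioi_rpow_of_lt hs1 hT
    simp only [hE] at this
    rw [hset]; exact this
  · intro r hr _
    rw [← zpow_natCast, ← zpow_add₀ hr.ne']
    apply le_of_eq; congr 1; push_cast [hn]; ring

lemma gs_main (n : ℕ) (p q : ℤ)
    (hp : 1 ≤ p) (hpn : p < (n : ℤ)) (hq : q < (n : ℤ)) (h : p + q < (n : ℤ)) :
    ∃ K : ℝ, 0 ≤ K ∧ ∀ ρ : ℝ, ∀ ξ : EuclideanSpace ℝ (Fin n),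
        (∫ z in ball (0 : EuclideanSpace ℝ (Fin n)) ρ,
            (1 + ‖z‖) ^ (q - (n : ℤ)) * ‖ξ - z‖ ^ (p - (n : ℤ)))
          ≤ K * ((1 + ‖ξ‖) ^ (p + q - (n : ℤ)) + (1 + ‖ξ‖) ^ (p - (n : ℤ)) *
            ∫ r in (1:ℝ)..(1 + 2 * (1 + ‖ξ‖)), r ^ (q - 1)) := by
  have hn : 1 ≤ n := by omega
  set v : ℝ := n * volume.real (ball (0 : EuclideanSpace ℝ (Fin n)) 1) with hv
  have hv0 : 0 ≤ v := by positivity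
  set s : ℤ := p + q - n with hsdef
  have hs : s < 0 := by omega
  set a : ℤ := q - n with ha
  set b : ℤ := p - n with hb
  have hs0 : (0:ℝ) < -s := by
    have : (s:ℝ) < 0 := by exact_mod_cast hs
    linarith
  have hp0 : (0:ℝ) < p := by exact_mod_cast (by omega : 0 < p)
  set c1 : ℝ := (1/2) ^ a * (v * ((1/2) ^ p / p)) with hc1
  set c2 : ℝ := (1/2) ^ b * v with hc2
  set c3 : ℝ := (1/2) ^ b * (v * (2 ^ s / (-s))) with hc3
  have h1 : 0 ≤ c1 := by positivity
  have h2 : 0 ≤ c2 := by positivity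
  have h3 : 0 ≤ c3 := by positivity
  refine ⟨c1 + c2 + c3, by positivity, fun ρ ξ => ?_⟩
  set R : ℝ := 1 + ‖ξ‖ with hR
  have hR0 : 0 < R := by positivity
  obtain ⟨iA, bA⟩ := gs_A n p hn hp (R / 2) (by positivity)
  obtain ⟨iB, bB⟩ := gs_B n q hn (2 * R) (by positivity)
  obtain ⟨iC, bC⟩ := gs_C n s hn hs (2 * R) (by positivity)
  set fA : EuclideanSpace ℝ (Fin n) → ℝ := fun x =>
    (Set.Iic (R/2)).indicator (fun r : ℝ => r ^ (p - (n:ℤ))) ‖x‖ with hfA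
  set fB : EuclideanSpace ℝ (Fin n) → ℝ := fun x =>
    (Set.Iic (2 * R)).indicator (fun r : ℝ => (1 + r) ^ (q - (n:ℤ))) ‖x‖ with hfB
  set fC : EuclideanSpace ℝ (Fin n) → ℝ := fun x =>
    (Set.Ioi (2 * R)).indicator (fun r : ℝ => r ^ (s - (n:ℤ))) ‖x‖ with hfC
  have iA' : Integrable (fun z => fA (ξ - z)) := iA.comp_sub_left ξ
  have bA' : ∫ z, fA (ξ - z) ≤ v * ((R / 2) ^ p / p) := by
    rw [integral_sub_left_eq_self fA volume ξ]; exact bA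
  have nA : ∀ x, 0 ≤ fA x := fun x => Set.indicator_apply_nonneg fun _ => by positivity
  have nB : ∀ x, 0 ≤ fB x := fun x => Set.indicator_apply_nonneg fun _ => by positivity
  have nC : ∀ x, 0 ≤ fC x := fun x => Set.indicator_apply_nonneg fun _ => by positivity
  have hpt : ∀ z, (1 + ‖z‖) ^ a * ‖ξ - z‖ ^ b ≤
      (R/2) ^ a * fA (ξ - z) + (R/2) ^ b * fB z + (1/2) ^ b * fC z := by
    intro z
    have e1 : 0 ≤ (R/2) ^ a * fA (ξ - z) := mul_nonneg (by positivity) (nA _)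
    have e2 : 0 ≤ (R/2) ^ b * fB z := mul_nonneg (by positivity) (nB _)
    have e3 : 0 ≤ (1/2) ^ b * fC z := mul_nonneg (by positivity) (nC _)
    have tri : ‖ξ‖ ≤ ‖ξ - z‖ + ‖z‖ := by simpa using norm_add_le (ξ - z) z
    have tri2 : ‖z‖ ≤ ‖ξ - z‖ + ‖ξ‖ := by
      rw [norm_sub_rev]; simpa using norm_add_le (z - ξ) ξ
    by_cases hA : ‖ξ - z‖ ≤ R / 2
    · have : fA (ξ - z) = ‖ξ - z‖ ^ b := Set.indicator_of_mem (show ‖ξ - z‖ ∈ Set.Iic (R/2) from hA) _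
      have k : (1 + ‖z‖) ^ a * ‖ξ - z‖ ^ b ≤ (R/2) ^ a * fA (ξ - z) := by
        rw [this]
        exact mul_le_mul_of_nonneg_right (gs_anti (by positivity) (by linarith) (by omega)) (by positivity)
      linarith
    · push Not at hA
      by_cases hB : ‖z‖ ≤ 2 * R
      · have : fB z = (1 + ‖z‖) ^ a := Set.indicator_of_mem (show ‖z‖ ∈ Set.Iic (2*R) from hB) _
        have k : (1 + ‖z‖) ^ a * ‖ξ - z‖ ^ b ≤ (R/2) ^ b * fB z := by
          rw [this, mul_comm]
          exact mul_le_mul_of_nonneg_right (gs_anti (by positivity) hA.le (by omega)) (by positivity)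
        linarith
      · push Not at hB
        have hz : 0 < ‖z‖ := by linarith
        have : fC z = ‖z‖ ^ (s - n) := Set.indicator_of_mem (show ‖z‖ ∈ Set.Ioi (2*R) from hB) _
        have k : (1 + ‖z‖) ^ a * ‖ξ - z‖ ^ b ≤ (1/2) ^ b * fC z := by
          calc (1 + ‖z‖) ^ a * ‖ξ - z‖ ^ b ≤ ‖z‖ ^ a * (1 / 2 * ‖z‖) ^ b := by
                refine mul_le_mul (gs_anti hz (by linarith) (by omega)) (gs_anti (by positivity) (by linarith) (by omega)) (by positivity) (by positivity)
            _ = (1/2) ^ b * fC z := by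
                rw [this, mul_zpow, show s - n = a + b by omega, zpow_add₀ hz.ne']; ring
        linarith
  have iG : Integrable (fun z => (R/2) ^ a * fA (ξ - z) + (R/2) ^ b * fB z + (1/2) ^ b * fC z) :=
    ((iA'.const_mul _).add (iB.const_mul _)).add (iC.const_mul _)
  set J := ∫ r in (1:ℝ)..(1 + 2 * R), r ^ (q - 1) with hJ
  have hJ0 : 0 ≤ J := by
    refine intervalIntegral.integral_nonneg (by linarith) fun r hr => ?_
    have : 0 ≤ r := by linarith [hr.1]
    positivity
  calc (∫ z in ball (0 : EuclideanSpace ℝ (Fin n)) ρ, (1 + ‖z‖) ^ a * ‖ξ - z‖ ^ b)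
      ≤ ∫ z in ball (0 : EuclideanSpace ℝ (Fin n)) ρ,
        ((R/2) ^ a * fA (ξ - z) + (R/2) ^ b * fB z + (1/2) ^ b * fC z) :=
        integral_mono_of_nonneg (Filter.Eventually.of_forall fun z => by positivity)
          iG.integrableOn (Filter.Eventually.of_forall hpt)
    _ ≤ ∫ z, ((R/2) ^ a * fA (ξ - z) + (R/2) ^ b * fB z + (1/2) ^ b * fC z) :=
        setIntegral_le_integral iG (Filter.Eventually.of_forall fun z =>
          le_trans (by positivity) (hpt z))
    _ = (R/2) ^ a * (∫ z, fA (ξ - z)) + (R/2) ^ b * (∫ z, fB z) + (1/2) ^ b * ∫ z, fC z := by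
        have iAB : Integrable (fun z => (R/2) ^ a * fA (ξ - z) + (R/2) ^ b * fB z) :=
          (iA'.const_mul _).add (iB.const_mul _)
        rw [integral_add iAB (iC.const_mul _),
          integral_add (iA'.const_mul _) (iB.const_mul _)]
        simp only [integral_const_mul]
    _ ≤ (R/2) ^ a * (v * ((R / 2) ^ p / p)) + (R/2) ^ b * (v * J) + (1/2) ^ b * (v * ((2 * R) ^ s / (-s))) := by
        gcongr
    _ = c1 * R ^ s + c2 * (R ^ b * J) + c3 * R ^ s := by
        rw [show R / 2 = 1/2 * R by ring]
        simp only [mul_zpow]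
        rw [show s = a + p by omega, zpow_add₀ hR0.ne', hc1, hc2, hc3, show s = a + p by omega]
        ring
    _ ≤ (c1 + c2 + c3) * (R ^ s + R ^ b * J) := by
        have : 0 ≤ R ^ s := by positivity
        have : 0 ≤ R ^ b * J := by positivity
        nlinarith [mul_nonneg h1 this, mul_nonneg h3 this, mul_nonneg h2 ‹0 ≤ R ^ s›]

/-- Giraud-type lemma, case `n > p + q`. -/
theorem giraud_subcritical (n : ℕ) (p q : ℤ)
    (hp : 1 ≤ p) (hpn : p < (n : ℤ)) (hq : q < (n : ℤ)) (h : p + q < (n : ℤ)) :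
    ∃ C : ℝ, 0 < C ∧ ∀ ρ : ℝ, 1 ≤ ρ → ∀ ξ : EuclideanSpace ℝ (Fin n), ‖ξ‖ ≤ ρ →
      (0 < q →
        (∫ z in ball (0 : EuclideanSpace ℝ (Fin n)) ρ,
            (1 + ‖z‖) ^ (q - (n : ℤ)) * ‖ξ - z‖ ^ (p - (n : ℤ)))
          ≤ C * (1 + ‖ξ‖) ^ (p + q - (n : ℤ)))
      ∧ (q = 0 →
        (∫ z in ball (0 : EuclideanSpace ℝ (Fin n)) ρ,
            (1 + ‖z‖) ^ (q - (n : ℤ)) * ‖ξ - z‖ ^ (p - (n : ℤ)))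
          ≤ C * (1 + ‖ξ‖) ^ (p - (n : ℤ)) * Real.log (2 + ‖ξ‖))
      ∧ (q < 0 →
        (∫ z in ball (0 : EuclideanSpace ℝ (Fin n)) ρ,
            (1 + ‖z‖) ^ (q - (n : ℤ)) * ‖ξ - z‖ ^ (p - (n : ℤ)))
          ≤ C * (1 + ‖ξ‖) ^ (p - (n : ℤ))) := by
  obtain ⟨K, hK, hmain⟩ := gs_main n p q hp hpn hq h
  have hint : ∀ x : ℝ, 0 ≤ x → q ≠ 0 →
      ∫ r in (1:ℝ)..(1 + 2 * (1 + x)), r ^ (q - 1) = ((1 + 2 * (1 + x)) ^ q - 1) / q := by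
    intro x hx hq0
    rw [integral_zpow]
    · simp
    · right
      refine ⟨by omega, ?_⟩
      rw [Set.uIcc_of_le (by linarith)]
      intro h0; linarith [h0.1]
  have hlog2 : 0 < Real.log 2 := Real.log_pos (by norm_num)
  rcases lt_trichotomy q 0 with hq0 | hq0 | hq0
  · have hqr : (q:ℝ) < 0 := by exact_mod_cast hq0
    refine ⟨K * (1 + 1 / (-q)) + 1, ?_, fun ρ _ ξ _ => ⟨fun _ => by omega, fun _ => by omega, fun _ => ?_⟩⟩
    · have : 0 < 1 / (-(q:ℝ)) := by apply one_div_pos.2; linarith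
      positivity
    refine (hmain ρ ξ).trans ?_
    rw [hint _ (norm_nonneg _) hq0.ne]
    have hRp : 0 < (1 + ‖ξ‖) ^ (p - (n:ℤ)) := by positivity
    have e1 : (1 + ‖ξ‖) ^ (p + q - (n:ℤ)) ≤ (1 + ‖ξ‖) ^ (p - (n:ℤ)) :=
      zpow_le_zpow_right₀ (by linarith [norm_nonneg ξ]) (by omega)
    have e2 : ((1 + 2 * (1 + ‖ξ‖)) ^ q - 1) / q ≤ 1 / (-(q:ℝ)) := by
      rw [← neg_div_neg_eq]
      have : 0 < (1 + 2 * (1 + ‖ξ‖)) ^ q := by positivity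
      apply div_le_div_of_nonneg_right _ (by linarith)
      linarith
    calc _ ≤ K * ((1 + ‖ξ‖) ^ (p - (n:ℤ)) + (1 + ‖ξ‖) ^ (p - (n:ℤ)) * (1 / (-(q:ℝ)))) := by gcongr
      _ ≤ _ := by linarith
  · subst hq0
    refine ⟨K * (1 / Real.log 2 + 2) + 1, by positivity, fun ρ _ ξ _ => ⟨fun _ => by omega, fun _ => ?_, fun _ => by omega⟩⟩
    refine (hmain ρ ξ).trans ?_
    have hx := norm_nonneg ξ
    have hJ : ∫ r in (1:ℝ)..(1 + 2 * (1 + ‖ξ‖)), r ^ ((0:ℤ) - 1) ≤ 2 * Real.log (2 + ‖ξ‖) := by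
      simp only [zero_sub, zpow_neg_one]
      rw [integral_inv_of_pos one_pos (by positivity), div_one]
      calc _ ≤ Real.log ((2 + ‖ξ‖) ^ 2) := Real.log_le_log (by positivity) (by nlinarith)
        _ = _ := by rw [Real.log_pow]; norm_num
    have hl : Real.log 2 ≤ Real.log (2 + ‖ξ‖) := Real.log_le_log (by norm_num) (by linarith)
    have hl1 : 1 ≤ 1 / Real.log 2 * Real.log (2 + ‖ξ‖) := by
      rw [one_div, inv_mul_eq_div, le_div_iff₀ hlog2]; linarith
    have hRp : 0 < (1 + ‖ξ‖) ^ (p - (n:ℤ)) := by positivity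
    rw [add_zero]
    calc _ ≤ K * ((1 + ‖ξ‖) ^ (p - (n:ℤ)) * (1 / Real.log 2 * Real.log (2 + ‖ξ‖)) + (1 + ‖ξ‖) ^ (p - (n:ℤ)) * (2 * Real.log (2 + ‖ξ‖))) := by
          gcongr
          exact le_mul_of_one_le_right hRp.le hl1
      _ ≤ _ := by
          have : 0 ≤ (1 + ‖ξ‖) ^ (p - (n:ℤ)) * Real.log (2 + ‖ξ‖) := mul_nonneg hRp.le (by linarith)
          linarith
  · have hqr : (0:ℝ) < q := by exact_mod_cast hq0
    refine ⟨K * (1 + 3 ^ q / q) + 1, by positivity, fun ρ _ ξ _ => ⟨fun _ => ?_, fun _ => by omega, fun _ => by omega⟩⟩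
    refine (hmain ρ ξ).trans ?_
    have hx := norm_nonneg ξ
    rw [hint _ hx hq0.ne']
    have hR : 0 < 1 + ‖ξ‖ := by positivity
    have e2 : ((1 + 2 * (1 + ‖ξ‖)) ^ q - 1) / q ≤ 3 ^ q * (1 + ‖ξ‖) ^ q / (q:ℝ) := by
      apply div_le_div_of_nonneg_right _ hqr.le
      rw [← mul_zpow]
      have := zpow_le_zpow_left₀ (n := q) hq0.le (by positivity) (show 1 + 2 * (1 + ‖ξ‖) ≤ 3 * (1 + ‖ξ‖) by linarith)
      linarith
    have hs : 0 < (1 + ‖ξ‖) ^ (p + q - (n:ℤ)) := by positivity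
    calc _ ≤ K * ((1 + ‖ξ‖) ^ (p + q - (n:ℤ)) + (1 + ‖ξ‖) ^ (p - (n:ℤ)) * (3 ^ q * (1 + ‖ξ‖) ^ q / (q:ℝ))) := by gcongr
      _ = K * (1 + 3 ^ q / q) * (1 + ‖ξ‖) ^ (p + q - (n:ℤ)) := by
          rw [show p + q - (n:ℤ) = (p - n) + q by ring, zpow_add₀ hR.ne']; ring
      _ ≤ _ := by linarith
end

section
/- Let n ≥ 3, let ℓ ≥ 0 be an integer, and let q ∈ ℝ satisfy 2−n < q+ℓ < 0. Then for every homogeneous polynomial T of degree ℓ on ℝⁿ there exists a homogeneous polynomial ψ of degree ℓ on ℝⁿ such that Δ₀(|x|^q ψ(x)) = |x|^{q−2} T(x) for all x ∈ ℝⁿ∖{0}. -/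
open MeasureTheory Metric Filter
open scoped RealInnerProductSpace

noncomputable section

/-- The nonnegative Euclidean Laplacian `Δ₀ u = -∑ᵢ ∂²u/∂xᵢ²` on `ℝⁿ`. -/
def lap (n : ℕ) (u : EuclideanSpace ℝ (Fin n) → ℝ) :
    EuclideanSpace ℝ (Fin n) → ℝ := fun x =>
  -∑ i : Fin n, iteratedFDeriv ℝ 2 u x
      ![EuclideanSpace.single i (1:ℝ), EuclideanSpace.single i (1:ℝ)]

/-- The iterated Laplacian `Δ₀^k`. -/
def lapIter (n k : ℕ) (u : EuclideanSpace ℝ (Fin n) → ℝ) :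
    EuclideanSpace ℝ (Fin n) → ℝ := (lap n)^[k] u

/-- `ψ : ℝⁿ → ℝ` is a homogeneous polynomial function of degree `ℓ`. -/
def IsHomogPoly (n ℓ : ℕ) (ψ : EuclideanSpace ℝ (Fin n) → ℝ) : Prop :=
  ∃ P : MvPolynomial (Fin n) ℝ, P.IsHomogeneous ℓ ∧
    ∀ x : EuclideanSpace ℝ (Fin n), ψ x = MvPolynomial.eval (fun i => x i) P

open MvPolynomial in
/-- Polynomial Laplacian. -/
def pL {n : ℕ} (P : MvPolynomial (Fin n) ℝ) : MvPolynomial (Fin n) ℝ :=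
  ∑ i : Fin n, pderiv i (pderiv i P)

open MvPolynomial in
/-- The polynomial `|x|^2`. -/
def pR (n : ℕ) : MvPolynomial (Fin n) ℝ := ∑ i : Fin n, X i ^ 2

open MvPolynomial in
theorem pR_hom (n : ℕ) : (pR n).IsHomogeneous 2 := by
  apply IsHomogeneous.sum
  intro i _
  exact isHomogeneous_X_pow i 2

open MvPolynomial in
theorem pL_hom {n ℓ : ℕ} {P : MvPolynomial (Fin n) ℝ} (h : P.IsHomogeneous ℓ) :
    (pL P).IsHomogeneous (ℓ - 2) := by
  apply IsHomogeneous.sum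
  intro i _
  exact h.pderiv.pderiv

open MvPolynomial in
theorem pL_low {n ℓ : ℕ} (hl : ℓ < 2) {P : MvPolynomial (Fin n) ℝ} (h : P.IsHomogeneous ℓ) :
    pL P = 0 := by
  apply Finset.sum_eq_zero
  intro i _
  have h1 : (pderiv i P).IsHomogeneous 0 := by
    have := h.pderiv (i := i)
    rwa [show ℓ - 1 = 0 by omega] at this
  rw [← totalDegree_zero_iff_isHomogeneous, totalDegree_eq_zero_iff_eq_C] at h1
  rw [h1, pderiv_C]

open MvPolynomial in
theorem pderiv_pR {n : ℕ} (i : Fin n) : pderiv i (pR n) = 2 * X i := by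
  unfold pR
  rw [map_sum, Finset.sum_eq_single i]
  · rw [pderiv_pow, pderiv_X_self]; ring
  · intro j _ hj
    rw [pderiv_pow, pderiv_X_of_ne hj]; ring
  · simp

open MvPolynomial in
theorem pL_pR_mul {n ℓ : ℕ} {Q : MvPolynomial (Fin n) ℝ} (h : Q.IsHomogeneous ℓ) :
    pL (pR n * Q) = C (2 * (n:ℝ) + 4 * ℓ) * Q + pR n * pL Q := by
  have h1 : ∀ i : Fin n, pderiv i (pderiv i (pR n * Q)) =
      2 * Q + 4 * (X i * pderiv i Q) + pR n * pderiv i (pderiv i Q) := by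
    intro i
    have h2 : pderiv i (2 : MvPolynomial (Fin n) ℝ) = 0 := by
      rw [show (2 : MvPolynomial (Fin n) ℝ) = C 2 from (map_ofNat C 2).symm, pderiv_C]
    simp only [pderiv_mul, map_add, pderiv_pR, h2, pderiv_X_self]
    ring
  unfold pL
  simp only [h1, Finset.sum_add_distrib, ← Finset.mul_sum, h.sum_X_mul_pderiv]
  have c2 : (C 2 : MvPolynomial (Fin n) ℝ) = 2 := map_ofNat C 2
  have c4 : (C 4 : MvPolynomial (Fin n) ℝ) = 4 := map_ofNat C 4
  simp [c2, c4]
  ring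

open MvPolynomial in
theorem exists_poly (n : ℕ) (d : ℝ) (hd : 2 - (n:ℝ) < d) (hd0 : d < 0) (ℓ : ℕ) :
    ∀ T : MvPolynomial (Fin n) ℝ, T.IsHomogeneous ℓ →
      ∃ P : MvPolynomial (Fin n) ℝ, P.IsHomogeneous ℓ ∧
        C ((d - ℓ) * (d + ℓ + n - 2)) * P + pR n * pL P = T := by
  induction ℓ using Nat.strong_induction_on with
  | _ ℓ ih =>
  intro T hT
  have hl0 : (0:ℝ) ≤ ℓ := Nat.cast_nonneg _
  set c : ℝ := (d - ℓ) * (d + ℓ + n - 2) with hc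
  have hc0 : c ≠ 0 := (mul_neg_of_neg_of_pos (by linarith) (by linarith)).ne
  have hcc : (C c : MvPolynomial (Fin n) ℝ) * C c⁻¹ = 1 := by
    rw [← C_mul, mul_inv_cancel₀ hc0, C_1]
  by_cases hl : ℓ < 2
  · have hP : (C c⁻¹ * T).IsHomogeneous ℓ := by
      simpa using (isHomogeneous_C (Fin n) c⁻¹).mul hT
    refine ⟨C c⁻¹ * T, hP, ?_⟩
    rw [pL_low hl hP, ← mul_assoc, hcc]; ring
  · obtain ⟨Q, hQ, hQe⟩ := ih (ℓ - 2) (by omega) (pL T) (pL_hom hT)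
    have hRQ : (pR n * Q).IsHomogeneous ℓ := by
      have := (pR_hom n).mul hQ
      rwa [show 2 + (ℓ - 2) = ℓ by omega] at this
    have hP : (C c⁻¹ * (T - pR n * Q)).IsHomogeneous ℓ := by
      simpa using (isHomogeneous_C (Fin n) c⁻¹).mul (hT.sub hRQ)
    refine ⟨_, hP, ?_⟩
    have hlin : pL (C c⁻¹ * (T - pR n * Q)) = C c⁻¹ * (pL T - pL (pR n * Q)) := by
      unfold pL
      simp only [pderiv_C_mul, map_sub, Finset.smul_sum, Finset.mul_sum,
        ← Finset.sum_sub_distrib, ← C_mul', map_smul]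
    have key : pL (C c⁻¹ * (T - pR n * Q)) = Q := by
      rw [hlin, pL_pR_mul hQ, ← hQe]
      have e : (d - ((ℓ - 2 : ℕ):ℝ)) * (d + ((ℓ - 2 : ℕ):ℝ) + n - 2)
          = c + (2 * (n:ℝ) + 4 * ((ℓ - 2 : ℕ):ℝ)) := by
        rw [hc]; push_cast [show 2 ≤ ℓ by omega]; ring
      rw [e, C_add]
      linear_combination Q * hcc
    rw [key]
    linear_combination (T - pR n * Q) * hcc

open MvPolynomial in
theorem hasFDeriv_poly {n : ℕ} (P : MvPolynomial (Fin n) ℝ) (x : EuclideanSpace ℝ (Fin n)) :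
    ∃ F : EuclideanSpace ℝ (Fin n) →L[ℝ] ℝ,
      HasFDerivAt (fun y : EuclideanSpace ℝ (Fin n) => eval (fun i => y i) P) F x ∧
      ∀ i, F (EuclideanSpace.single i 1) = eval (fun i => x i) (pderiv i P) := by
  induction P using MvPolynomial.induction_on with
  | C a => exact ⟨0, by simpa using hasFDerivAt_const a x, by simp⟩
  | add p q hp hq =>
    obtain ⟨F, hF, hF'⟩ := hp
    obtain ⟨G, hG, hG'⟩ := hq
    refine ⟨F + G, ?_, ?_⟩
    · simp only [map_add]
      exact hF.add hG
    · intro i; simp [hF', hG']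
  | mul_X p j hp =>
    obtain ⟨F, hF, hF'⟩ := hp
    have hX : HasFDerivAt (fun y : EuclideanSpace ℝ (Fin n) => y j)
      (EuclideanSpace.proj j : EuclideanSpace ℝ (Fin n) →L[ℝ] ℝ) x :=
      (EuclideanSpace.proj j : EuclideanSpace ℝ (Fin n) →L[ℝ] ℝ).hasFDerivAt
    simp only [map_mul, eval_X]
    refine ⟨_, hF.mul hX, ?_⟩
    intro i
    by_cases hij : j = i
    · subst hij
      simp [hF', pderiv_mul, mul_comm, add_comm]
    · simp [hF', pderiv_mul, pderiv_X_of_ne hij, hij, mul_comm]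

open MvPolynomial in
theorem hasFDeriv_main {n : ℕ} (q : ℝ) (P : MvPolynomial (Fin n) ℝ)
    (x : EuclideanSpace ℝ (Fin n)) (hx : x ≠ 0) :
    ∃ F : EuclideanSpace ℝ (Fin n) →L[ℝ] ℝ,
      HasFDerivAt (fun y : EuclideanSpace ℝ (Fin n) => ‖y‖ ^ q * eval (fun i => y i) P) F x ∧
      ∀ i, F (EuclideanSpace.single i 1) =
        q * (‖x‖ ^ (q - 2) * eval (fun i => x i) (X i * P))
          + ‖x‖ ^ q * eval (fun i => x i) (pderiv i P) := by
  obtain ⟨F, hF, hF'⟩ := hasFDeriv_poly P x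
  have hpos : 0 < ‖x‖ := norm_pos_iff.mpr hx
  have h2 : (fun y : EuclideanSpace ℝ (Fin n) => ‖y‖ ^ q) =
      fun y => (‖y‖ ^ 2) ^ (q / 2) := by
    funext y
    rw [← Real.rpow_natCast, ← Real.rpow_mul (norm_nonneg y)]
    congr 1; push_cast; ring
  have h1 := (hasStrictFDerivAt_norm_sq x).hasFDerivAt.rpow_const (p := q / 2)
    (Or.inl (by positivity))
  rw [← h2] at h1
  refine ⟨_, h1.mul hF, ?_⟩
  intro i
  have h3 : (‖x‖ ^ 2) ^ (q / 2 - 1) = ‖x‖ ^ (q - 2) := by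
    rw [← Real.rpow_natCast, ← Real.rpow_mul (norm_nonneg x)]
    congr 1; push_cast; ring
  simp [hF', h3, EuclideanSpace.inner_single_right]
  ring

open MvPolynomial in
theorem second_deriv {n : ℕ} (q : ℝ) (P : MvPolynomial (Fin n) ℝ)
    (x : EuclideanSpace ℝ (Fin n)) (hx : x ≠ 0) (i : Fin n) :
    iteratedFDeriv ℝ 2 (fun y : EuclideanSpace ℝ (Fin n) => ‖y‖ ^ q * eval (fun i => y i) P) x
      ![EuclideanSpace.single i (1:ℝ), EuclideanSpace.single i (1:ℝ)] =
      q * ((q - 2) * (‖x‖ ^ (q - 2 - 2) * eval (fun i => x i) (X i * (X i * P)))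
          + ‖x‖ ^ (q - 2) * eval (fun i => x i) (pderiv i (X i * P)))
      + (q * (‖x‖ ^ (q - 2) * eval (fun i => x i) (X i * pderiv i P))
          + ‖x‖ ^ q * eval (fun i => x i) (pderiv i (pderiv i P))) := by
  set u : EuclideanSpace ℝ (Fin n) → ℝ := fun y => ‖y‖ ^ q * eval (fun i => y i) P with hu
  have hsm : ContDiffAt ℝ 2 u x := by
    apply ContDiffAt.mul
    · exact (contDiffAt_norm ℝ hx).rpow_const_of_ne (norm_ne_zero_iff.mpr hx)
    · have : AnalyticAt ℝ (fun y : EuclideanSpace ℝ (Fin n) => aeval (fun i => y i) P) x :=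
        AnalyticAt.aeval_mvPolynomial (fun i =>
          (EuclideanSpace.proj i : EuclideanSpace ℝ (Fin n) →L[ℝ] ℝ).analyticAt x) P
      exact this.contDiffAt
  have hd : DifferentiableAt ℝ (fderiv ℝ u) x :=
    (hsm.fderiv_right (m := 1) (by norm_num)).differentiableAt (by norm_num)
  rw [iteratedFDeriv_two_apply]
  simp only [Matrix.cons_val_zero, Matrix.cons_val_one]
  have e1 : (fun y => fderiv ℝ u y (EuclideanSpace.single i 1)) =ᶠ[nhds x]
      fun y => q * (‖y‖ ^ (q - 2) * eval (fun i => y i) (X i * P))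
          + ‖y‖ ^ q * eval (fun i => y i) (pderiv i P) := by
    filter_upwards [isOpen_ne.mem_nhds hx] with y hy
    obtain ⟨F, hF, hF'⟩ := hasFDeriv_main q P y hy
    rw [hu, hF.fderiv, hF']
  obtain ⟨F, hF, hF'⟩ := hasFDeriv_main (q - 2) (X i * P) x hx
  obtain ⟨G, hG, hG'⟩ := hasFDeriv_main q (pderiv i P) x hx
  have e2 := ((hF.const_mul q).add hG).congr_of_eventuallyEq e1
  have e3 := hd.hasFDerivAt.clm_apply (hasFDerivAt_const (EuclideanSpace.single i (1:ℝ)) x)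
  have e4 := congrArg (fun L => L (EuclideanSpace.single i (1:ℝ))) (e3.unique e2)
  simp only [ContinuousLinearMap.add_apply, ContinuousLinearMap.smul_apply, hF', hG',
    smul_eq_mul] at e4
  rw [← e4]
  simp

open MvPolynomial in
theorem lap_main {n ℓ : ℕ} (q : ℝ) (P : MvPolynomial (Fin n) ℝ) (hP : P.IsHomogeneous ℓ)
    (x : EuclideanSpace ℝ (Fin n)) (hx : x ≠ 0) :
    lap n (fun y => ‖y‖ ^ q * eval (fun i => y i) P) x =
      -(‖x‖ ^ (q - 2) * eval (fun i => x i) (C (q * (q + 2 * ℓ + n - 2)) * P + pR n * pL P)) := by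
  unfold lap
  have hpos : 0 < ‖x‖ := norm_pos_iff.mpr hx
  have hR : eval (fun i => x i) (pR n) = ‖x‖ ^ 2 := by
    simp [pR, EuclideanSpace.real_norm_sq_eq]
  have hE := congrArg (eval (fun i => x i)) hP.sum_X_mul_pderiv
  have p1 : ‖x‖ ^ (q - 2) = ‖x‖ ^ (q - 2 - 2) * ‖x‖ ^ 2 := by
    rw [← Real.rpow_natCast, ← Real.rpow_add hpos]; congr 1; push_cast; ring
  have p2 : ‖x‖ ^ q = ‖x‖ ^ (q - 2) * ‖x‖ ^ 2 := by
    rw [← Real.rpow_natCast, ← Real.rpow_add hpos]; congr 1; push_cast; ring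
  have hS : ∑ i : Fin n, x i ^ 2 = ‖x‖ ^ 2 := (EuclideanSpace.real_norm_sq_eq x).symm
  have hL : eval (fun i => x i) (pL P) =
    ∑ i, eval (fun i => x i) (pderiv i (pderiv i P)) := by simp [pL]
  simp only [map_sum, map_mul, eval_X, nsmul_eq_mul, map_natCast] at hE
  simp only [second_deriv q P x hx]
  have step : ∀ i : Fin n,
      q * ((q - 2) * (‖x‖ ^ (q - 2 - 2) * eval (fun i => x i) (X i * (X i * P)))
          + ‖x‖ ^ (q - 2) * eval (fun i => x i) (pderiv i (X i * P)))
      + (q * (‖x‖ ^ (q - 2) * eval (fun i => x i) (X i * pderiv i P))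
          + ‖x‖ ^ q * eval (fun i => x i) (pderiv i (pderiv i P)))
      = (q * (q - 2) * ‖x‖ ^ (q - 2 - 2) * eval (fun i => x i) P) * x i ^ 2
        + q * ‖x‖ ^ (q - 2) * eval (fun i => x i) P
        + (2 * q * ‖x‖ ^ (q - 2)) * (x i * eval (fun i => x i) (pderiv i P))
        + ‖x‖ ^ q * eval (fun i => x i) (pderiv i (pderiv i P)) := by
    intro i
    simp only [pderiv_mul, pderiv_X_self, map_add, map_mul, eval_X, map_one]
    ring
  rw [Finset.sum_congr rfl (fun i _ => step i)]
  simp only [Finset.sum_add_distrib, ← Finset.mul_sum, hE, hS, ← hL, Finset.sum_const,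
    Finset.card_univ, Fintype.card_fin, nsmul_eq_mul, map_add, map_mul, eval_C, hR]
  rw [p2, p1]
  ring

/-- for `2−n < q+ℓ < 0`, every homogeneous polynomial `T` of degree
`ℓ` can be written as `|x|^{q-2} T = Δ₀(|x|^q ψ)` for some homogeneous polynomial `ψ`
of degree `ℓ`. -/
theorem exists_homogeneous_preimage (n : ℕ) (hn : 3 ≤ n) (ℓ : ℕ) (q : ℝ)
    (hql : 2 - (n:ℝ) < q + ℓ) (hq0 : q + (ℓ:ℝ) < 0) :
    ∀ T : EuclideanSpace ℝ (Fin n) → ℝ, IsHomogPoly n ℓ T →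
      ∃ ψ : EuclideanSpace ℝ (Fin n) → ℝ, IsHomogPoly n ℓ ψ ∧
        ∀ x : EuclideanSpace ℝ (Fin n), x ≠ 0 →
          lap n (fun y => ‖y‖ ^ q * ψ y) x = ‖x‖ ^ (q - 2) * T x := by
  rintro T ⟨T', hT', hT⟩
  obtain ⟨P, hP, hPe⟩ := exists_poly n (q + ℓ) hql hq0 ℓ (-T') hT'.neg
  refine ⟨fun y => MvPolynomial.eval (fun i => y i) P, ⟨P, hP, fun _ => rfl⟩, ?_⟩
  intro x hx
  rw [lap_main q P hP x hx, hT]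
  have e : (q + ℓ - ℓ) * (q + ℓ + ℓ + n - 2) = q * (q + 2 * ℓ + n - 2) := by ring
  rw [e] at hPe
  rw [hPe]
  simp
end
end

section
/- Let n and k be integers with k ≥ 1, n > 2k and n ≠ 2k+2, and let ψ be a harmonic homogeneous polynomial of degree 2 on ℝⁿ (that is, ψ is a homogeneous polynomial of degree 2 with Δ₀ψ = 0). Then there exists a nonzero constant C depending only on n and k such that Δ₀^k(|x|^{2k+2−n} ψ(x)) = C · |x|^{2−n} ψ(x) for all x ∈ ℝⁿ∖{0}. -/
open MeasureTheory Metric Filter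
open scoped RealInnerProductSpace

noncomputable section

lemma aux_rpow {n : ℕ} (a : ℝ) (x : EuclideanSpace ℝ (Fin n)) (hx : x ≠ 0) :
    HasFDerivAt (fun y : EuclideanSpace ℝ (Fin n) => ‖y‖ ^ a)
      ((a * ‖x‖ ^ (a - 2)) • innerSL ℝ x) x := by
  have h1 := (hasStrictFDerivAt_norm_sq x).hasFDerivAt
  have hpos : 0 < ‖x‖ := norm_pos_iff.mpr hx
  have h2 := h1.rpow_const (p := a / 2) (Or.inl (by positivity))
  have e1 : ∀ (y : EuclideanSpace ℝ (Fin n)) (b : ℝ), (‖y‖ ^ 2) ^ b = ‖y‖ ^ (2 * b) := by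
    intro y b
    rw [← Real.rpow_natCast, ← Real.rpow_mul (norm_nonneg y)]
    norm_num
  have e2 : (fun y : EuclideanSpace ℝ (Fin n) => ‖y‖ ^ a)
      = fun y => (‖y‖ ^ 2) ^ (a / 2) := by
    funext y
    rw [e1]; congr 1; ring
  rw [e2]
  refine h2.congr_fderiv ?_
  rw [e1, show 2 * (a / 2 - 1) = a - 2 by ring]
  ext v
  simp
  ring

lemma aux_second {n : ℕ} (f : EuclideanSpace ℝ (Fin n) → ℝ) (x e : EuclideanSpace ℝ (Fin n))
    (hf : ContDiffAt ℝ 2 f x) :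
    iteratedFDeriv ℝ 2 f x ![e, e] = fderiv ℝ (fun y => fderiv ℝ f y e) x e := by
  rw [iteratedFDeriv_two_apply]
  have : DifferentiableAt ℝ (fderiv ℝ f) x :=
    (hf.fderiv_right (m := 1) (by norm_num)).differentiableAt (by norm_num)
  rw [fderiv_clm_apply this (by fun_prop)]
  simp

lemma aux_dir {n : ℕ} (a : ℝ) (ψ : EuclideanSpace ℝ (Fin n) → ℝ) (hψ : ContDiff ℝ 2 ψ)
    (x e : EuclideanSpace ℝ (Fin n)) (hx : x ≠ 0) :
    iteratedFDeriv ℝ 2 (fun y => ‖y‖ ^ a * ψ y) x ![e, e]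
      = a * (a - 2) * ‖x‖ ^ (a - 4) * (inner ℝ x e) ^ 2 * ψ x
        + a * ‖x‖ ^ (a - 2) * ‖e‖ ^ 2 * ψ x
        + 2 * a * ‖x‖ ^ (a - 2) * (inner ℝ x e * fderiv ℝ ψ x e)
        + ‖x‖ ^ a * iteratedFDeriv ℝ 2 ψ x ![e, e] := by
  have hpos : 0 < ‖x‖ := norm_pos_iff.mpr hx
  have hd : Differentiable ℝ ψ := hψ.differentiable (by norm_num)
  have hcd : ContDiffAt ℝ 2 (fun y => ‖y‖ ^ a * ψ y) x :=
    ((contDiffAt_norm ℝ hx).rpow_const_of_ne hpos.ne').mul hψ.contDiffAt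
  rw [aux_second _ x e hcd,
    aux_second _ x e hψ.contDiffAt]
  have hd2 : DifferentiableAt ℝ (fun y => fderiv ℝ ψ y e) x := by
    have : DifferentiableAt ℝ (fderiv ℝ ψ) x :=
      (hψ.contDiffAt.fderiv_right (m := 1) (by norm_num)).differentiableAt (by norm_num)
    exact this.clm_apply (by fun_prop)
  have hev : (fun y => fderiv ℝ (fun y => ‖y‖ ^ a * ψ y) y e) =ᶠ[nhds x]
      fun y => ‖y‖ ^ a * fderiv ℝ ψ y e + ψ y * (a * ‖y‖ ^ (a - 2) * inner ℝ y e) := by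
    filter_upwards [isOpen_ne.mem_nhds hx] with y hy
    have h0 := ((aux_rpow a y hy).mul (hd y).hasFDerivAt).fderiv
    have h1 := congrArg (fun L => L e) h0
    refine Eq.trans h1 ?_
    simp
  have hin : HasFDerivAt (fun y : EuclideanSpace ℝ (Fin n) => inner ℝ y e) (innerSL ℝ e) x := by
    have := (innerSL ℝ e).hasFDerivAt (x := x)
    convert this using 1
    funext y
    simp [real_inner_comm]
  rw [hev.fderiv_eq]
  have H := ((aux_rpow a x hx).mul hd2.hasFDerivAt).add
    ((hd x).hasFDerivAt.mul (((aux_rpow (a - 2) x hx).const_mul a).mul hin))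
  have H' := H.fderiv
  erw [H']
  simp
  rw [show a - 2 - 2 = a - 4 by ring]
  ring

lemma aux_lap {n : ℕ} (a c : ℝ) (ψ : EuclideanSpace ℝ (Fin n) → ℝ) (hψ : ContDiff ℝ 2 ψ)
    (hE : ∀ x, fderiv ℝ ψ x x = 2 * ψ x) (hl : ∀ x, lap n ψ x = 0)
    (f : EuclideanSpace ℝ (Fin n) → ℝ) (hf : ∀ y, y ≠ 0 → f y = c * ‖y‖ ^ a * ψ y)
    (x : EuclideanSpace ℝ (Fin n)) (hx : x ≠ 0) :
    lap n f x = (-(c * (a * (a + n + 2)))) * ‖x‖ ^ (a - 2) * ψ x := by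
  have hpos : 0 < ‖x‖ := norm_pos_iff.mpr hx
  have hev : f =ᶠ[nhds x] fun y => ‖y‖ ^ a * (c * ψ y) := by
    filter_upwards [isOpen_ne.mem_nhds hx] with y hy
    rw [hf y hy]; ring
  have hψc : ContDiff ℝ 2 (fun y => c * ψ y) := contDiff_const.mul hψ
  have hlx := hl x
  unfold lap at hlx ⊢
  rw [(Filter.EventuallyEq.iteratedFDeriv ℝ hev 2).eq_of_nhds]
  have hs : ∀ e, iteratedFDeriv ℝ 2 (fun y => c * ψ y) x ![e, e]
      = c * iteratedFDeriv ℝ 2 ψ x ![e, e] := by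
    intro e
    have := iteratedFDeriv_const_smul_apply (𝕜 := ℝ) (i := 2) (a := c) (f := ψ) (x := x)
      hψ.contDiffAt
    have h2 := congrArg (fun m => m ![e, e]) this
    exact h2
  have hf1 : ∀ e, fderiv ℝ (fun y => c * ψ y) x e = c * fderiv ℝ ψ x e := by
    intro e
    rw [fderiv_const_mul (hψ.differentiable (by norm_num) x)]
    simp
  have hsum1 : ∑ i : Fin n, x i ^ 2 = ‖x‖ ^ 2 := by
    rw [EuclideanSpace.norm_sq_eq]; simp
  have hsum2 : ∑ i : Fin n, x i * fderiv ℝ ψ x (EuclideanSpace.single i (1:ℝ)) = 2 * ψ x := by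
    rw [← hE x]
    have hx' : x = ∑ i : Fin n, x i • EuclideanSpace.single i (1:ℝ) := by
      ext j
      simp [Pi.single_apply]
    conv_rhs => rw [show fderiv ℝ ψ x x = fderiv ℝ ψ x (∑ i : Fin n, x i • EuclideanSpace.single i (1:ℝ)) by rw [← hx']]
    rw [map_sum]
    simp
  have hsum3 : ∑ i : Fin n, iteratedFDeriv ℝ 2 ψ x
      ![EuclideanSpace.single i (1:ℝ), EuclideanSpace.single i (1:ℝ)] = 0 := by linarith
  have hin : ∀ i : Fin n, inner ℝ x (EuclideanSpace.single i (1:ℝ)) = x i := by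
    intro i; simp [EuclideanSpace.inner_single_right]
  have hne : ∀ i : Fin n, ‖EuclideanSpace.single i (1:ℝ)‖ = 1 := by
    intro i; simp
  simp_rw [aux_dir a _ hψc x _ hx, hs, hf1, hin, hne]
  have e4 : ‖x‖ ^ (a - 4) * ‖x‖ ^ 2 = ‖x‖ ^ (a - 2) := by
    rw [← Real.rpow_natCast, ← Real.rpow_add hpos]; congr 1; push_cast; ring
  have : ∀ i : Fin n, a * (a - 2) * ‖x‖ ^ (a - 4) * x i ^ 2 * (c * ψ x)
        + a * ‖x‖ ^ (a - 2) * 1 ^ 2 * (c * ψ x)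
        + 2 * a * ‖x‖ ^ (a - 2) * (x i * (c * fderiv ℝ ψ x (EuclideanSpace.single i (1:ℝ))))
        + ‖x‖ ^ a * (c * iteratedFDeriv ℝ 2 ψ x
          ![EuclideanSpace.single i (1:ℝ), EuclideanSpace.single i (1:ℝ)])
      = (a * (a - 2) * ‖x‖ ^ (a - 4) * (c * ψ x)) * x i ^ 2
        + a * ‖x‖ ^ (a - 2) * (c * ψ x)
        + (2 * a * ‖x‖ ^ (a - 2) * c) * (x i * fderiv ℝ ψ x (EuclideanSpace.single i (1:ℝ)))
        + (‖x‖ ^ a * c) * iteratedFDeriv ℝ 2 ψ x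
          ![EuclideanSpace.single i (1:ℝ), EuclideanSpace.single i (1:ℝ)] := by
    intro i; ring
  simp_rw [this, Finset.sum_add_distrib, ← Finset.mul_sum]
  rw [hsum1, hsum2, hsum3]
  simp
  linear_combination (-(a * (a - 2) * (c * ψ x))) * e4

lemma aux_poly {n : ℕ} (ψ : EuclideanSpace ℝ (Fin n) → ℝ) (h : IsHomogPoly n 2 ψ) :
    ContDiff ℝ 2 ψ ∧ ∀ x, fderiv ℝ ψ x x = 2 * ψ x := by
  obtain ⟨P, hP, hψ⟩ := h
  have hc : ContDiff ℝ 2 ψ := by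
    have : ψ = fun x => ∑ d ∈ P.support, P.coeff d * ∏ i : Fin n, x i ^ d i := by
      funext x
      rw [hψ x, MvPolynomial.eval_eq']
    rw [this]
    fun_prop
  refine ⟨hc, fun x => ?_⟩
  have hhom : ∀ t : ℝ, ψ (t • x) = t ^ 2 * ψ x := by
    intro t
    rw [hψ, hψ, MvPolynomial.eval_eq', MvPolynomial.eval_eq', Finset.mul_sum]
    refine Finset.sum_congr rfl fun d hd => ?_
    have hdeg := hP (MvPolynomial.mem_support_iff.mp hd)
    have hdeg' : ∑ i : Fin n, d i = 2 := by
      rw [← hdeg, Finsupp.weight_apply, Finsupp.sum_fintype _ _ (by simp)]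
      simp
    simp only [PiLp.smul_apply, smul_eq_mul, mul_pow, Finset.prod_mul_distrib]
    rw [Finset.prod_pow_eq_pow_sum, hdeg']
    ring
  have h1 : HasDerivAt (fun t : ℝ => t • x) x 1 := by
    simpa using (hasDerivAt_id (1:ℝ)).smul_const x
  have hd : HasFDerivAt ψ (fderiv ℝ ψ x) ((1:ℝ) • x) := by
    rw [one_smul]
    exact (hc.differentiable (by norm_num) x).hasFDerivAt
  have h2 := hd.comp_hasDerivAt (1:ℝ) h1
  have h3 : HasDerivAt (fun t : ℝ => t ^ 2 * ψ x) (2 * ψ x) 1 := by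
    simpa using (hasDerivAt_pow 2 (1:ℝ)).mul_const (ψ x)
  have h4 : (ψ ∘ fun t : ℝ => t • x) = fun t : ℝ => t ^ 2 * ψ x := funext hhom
  rw [h4] at h2
  exact h2.unique h3

lemma aux_iter (n : ℕ) (m : ℕ) (h : ∀ j : ℕ, 1 ≤ j → j ≤ m → n ≠ 2 * j + 2) :
    ∃ C : ℝ, C ≠ 0 ∧
      ∀ ψ : EuclideanSpace ℝ (Fin n) → ℝ, IsHomogPoly n 2 ψ →
        (∀ x, lap n ψ x = 0) → ∀ (f : EuclideanSpace ℝ (Fin n) → ℝ) (c : ℝ),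
        (∀ y, y ≠ 0 → f y = c * ‖y‖ ^ (2 * (m:ℝ) + 2 - n) * ψ y) →
        ∀ x, x ≠ 0 → lapIter n m f x = C * c * ‖x‖ ^ (2 - (n:ℝ)) * ψ x := by
  induction m with
  | zero =>
    refine ⟨1, one_ne_zero, fun ψ _ _ f c hf x hx => ?_⟩
    simpa [lapIter] using hf x hx
  | succ m ih =>
    obtain ⟨C, hC, H⟩ := ih fun j h1 h2 => h j h1 (by omega)
    set a : ℝ := 2 * ((m + 1 : ℕ):ℝ) + 2 - n with ha
    refine ⟨C * (-(a * (a + n + 2))), mul_ne_zero hC (neg_ne_zero.mpr (mul_ne_zero ?_ ?_)),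
      fun ψ hψ hl f c hf x hx => ?_⟩
    · intro h0
      apply h (m + 1) (by omega) le_rfl
      have : (n : ℝ) = ((2 * (m + 1) + 2 : ℕ) : ℝ) := by
        push_cast at ha ⊢; linarith
      exact_mod_cast this
    · have : a + n + 2 = 2 * (m:ℝ) + 6 := by rw [ha]; push_cast; ring
      rw [this]; positivity
    · obtain ⟨hc, hE⟩ := aux_poly ψ hψ
      have := H ψ hψ hl (lap n f) (-(c * (a * (a + n + 2)))) (fun y hy => by
        rw [aux_lap a c ψ hc hE hl f hf y hy]
        rw [show a - 2 = 2 * (m:ℝ) + 2 - n by rw [ha]; push_cast; ring]) x hx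
      have h2 : lapIter n (m + 1) f x = lapIter n m (lap n f) x := by
        simp [lapIter, Function.iterate_succ_apply]
      rw [h2, this]; ring

/-- for a harmonic homogeneous polynomial `ψ` of degree `2`,
`Δ₀^k(|x|^{2k+2-n} ψ) = C |x|^{2-n} ψ` for a nonzero constant `C = C(n,k)`. -/
theorem lapIter_harmonic_quadratic (n k : ℕ) (hk : 1 ≤ k) (hn : 2*k < n)
    (hn' : n ≠ 2*k + 2) :
    ∃ C : ℝ, C ≠ 0 ∧
      ∀ ψ : EuclideanSpace ℝ (Fin n) → ℝ, IsHomogPoly n 2 ψ →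
        (∀ x : EuclideanSpace ℝ (Fin n), lap n ψ x = 0) →
        ∀ x : EuclideanSpace ℝ (Fin n), x ≠ 0 →
          lapIter n k (fun y => ‖y‖ ^ (2*(k:ℝ) + 2 - n) * ψ y) x
            = C * ‖x‖ ^ (2 - (n:ℝ)) * ψ x := by
  obtain ⟨C, hC, H⟩ := aux_iter n k fun j h1 h2 => by omega
  refine ⟨C, hC, fun ψ hψ hl x hx => ?_⟩
  have := H ψ hψ hl (fun y => ‖y‖ ^ (2*(k:ℝ) + 2 - n) * ψ y) 1 (fun y _ => by ring) x hx
  rw [this]; ring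
end
end

section
/- Let n and k be integers with k ≥ 1 and n > 2k, let m ≥ 1 be an integer, and let ψ be a homogeneous polynomial of degree m on ℝⁿ with ∫_{∂B(0,1)} ψ dσ = 0. Define R₀(x) := |x|^{2k−n} ψ(x) on ℝⁿ∖{0}. Then for every integer i ≥ 0 and every r > 0 one has ∫_{∂B(0,r)} Δ₀^i R₀ dσ = 0 and ∫_{∂B(0,r)} ⟨x, ∇(Δ₀^i R₀)(x)⟩ dσ(x) = 0. -/
open MeasureTheory Metric Filter
open scoped RealInnerProductSpace

noncomputable section

/-- The radial derivative `⟨x, ∇u(x)⟩`. -/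
def xGrad (n : ℕ) (u : EuclideanSpace ℝ (Fin n) → ℝ)
    (x : EuclideanSpace ℝ (Fin n)) : ℝ := ⟪x, gradient u x⟫

/-- Surface integral over the sphere `∂B(0,r) ⊆ ℝⁿ` with respect to the
`(n-1)`-dimensional Hausdorff measure. -/
def sInt (n : ℕ) (r : ℝ) (f : EuclideanSpace ℝ (Fin n) → ℝ) : ℝ :=
  ∫ x in sphere (0 : EuclideanSpace ℝ (Fin n)) r, f x ∂(μH[(n:ℝ) - 1])

open scoped ContDiff
local notation "EE" n => EuclideanSpace ℝ (Fin n)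

theorem sphere_finite (n : ℕ) (hn : 1 ≤ n) (r : ℝ) (hr : 0 < r) :
    μH[(n:ℝ) - 1] (sphere (0 : EuclideanSpace ℝ (Fin n)) r) < ⊤ := by
  obtain ⟨n, rfl⟩ : ∃ l, n = l + 1 := ⟨n - 1, by omega⟩
  have e : ((n + 1 : ℕ) : ℝ) - 1 = n := by push_cast; ring
  rw [e]
  let w : Fin (n+1) → (Fin n → ℝ) → EuclideanSpace ℝ (Fin (n+1)) := fun i y =>
    WithLp.toLp 2 (i.insertNth (1:ℝ) y : Fin (n+1) → ℝ)
  let g : ℝ → Fin (n+1) → (Fin n → ℝ) → EuclideanSpace ℝ (Fin (n+1)) := fun c i y =>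
    (c / ‖w i y‖) • w i y
  let Q : Set (Fin n → ℝ) := Set.Icc (fun _ => -1) (fun _ => 1)
  have hw0 : ∀ i y, w i y ≠ 0 := by
    intro i y h
    have : (w i y) i = 0 := by rw [h]; simp
    simp [w] at this
  have hwC : ∀ i, ContDiff ℝ 1 (w i) := by
    intro i
    rw [contDiff_euclidean]
    intro j
    refine Fin.succAboveCases i ?_ ?_ j
    · simp only [w, Fin.insertNth_apply_same]; exact contDiff_const
    · intro l; simp only [w, Fin.insertNth_apply_succAbove]; exact contDiff_apply _ _ _
  have hgC : ∀ c i, ContDiff ℝ 1 (g c i) := by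
    intro c i
    exact (contDiff_const.div ((hwC i).norm ℝ (hw0 i)) (fun y => norm_ne_zero_iff.2 (hw0 i y))).smul (hwC i)
  have hfin : ∀ c i, μH[(n:ℝ)] (g c i '' Q) < ⊤ := by
    intro c i
    obtain ⟨K, hK⟩ := (hgC c i).contDiffOn.exists_lipschitzOnWith (s := Q) (by simp)
      (convex_Icc _ _) isCompact_Icc
    refine (hK.hausdorffMeasure_image_le (by positivity)).trans_lt ?_
    have : (μH[(n:ℝ)] : Measure (Fin n → ℝ)) = volume := by
      simpa using hausdorffMeasure_pi_real (ι := Fin n)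
    rw [this]
    exact ENNReal.mul_lt_top (by simp) isCompact_Icc.measure_lt_top
  have hsub : sphere (0 : EuclideanSpace ℝ (Fin (n+1))) r ⊆
      ⋃ i, (g r i '' Q ∪ g (-r) i '' Q) := by
    intro x hx
    have hx : ‖x‖ = r := by simpa using hx
    obtain ⟨i, hi⟩ := Finite.exists_max (fun i => |x i|)
    have hxi : x i ≠ 0 := by
      intro h
      have : x = 0 := by
        ext j
        have := hi j
        simp only [h, abs_zero, abs_nonpos_iff] at this
        simpa using this
      rw [this] at hx; simp at hx; linarith
    let y : Fin n → ℝ := fun j => x (i.succAbove j) / x i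
    have hy : y ∈ Q := by
      have : ∀ j, |y j| ≤ 1 := by
        intro j
        simp only [y, abs_div]
        exact div_le_one_of_le₀ (hi _) (abs_nonneg _)
      exact ⟨fun j => (abs_le.1 (this j)).1, fun j => (abs_le.1 (this j)).2⟩
    have hwx : x = x i • w i y := by
      ext j
      refine Fin.succAboveCases i ?_ ?_ j
      · simp [w]
      · intro l; simp [w, y]; field_simp
    have hnw : r = |x i| * ‖w i y‖ := by
      rw [← hx]; conv_lhs => rw [hwx]
      rw [norm_smul, Real.norm_eq_abs]
    have hn0 := norm_ne_zero_iff.2 (hw0 i y)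
    simp only [Set.mem_iUnion, Set.mem_union]
    refine ⟨i, ?_⟩
    rcases lt_or_gt_of_ne hxi with h | h
    · right
      refine ⟨y, hy, ?_⟩
      rw [abs_of_neg h] at hnw
      simp only [g]
      conv_rhs => rw [hwx]
      congr 1
      rw [hnw]; field_simp
    · left
      refine ⟨y, hy, ?_⟩
      rw [abs_of_pos h] at hnw
      simp only [g]
      conv_rhs => rw [hwx]
      congr 1
      rw [hnw]; field_simp
  refine (measure_mono hsub).trans_lt ((measure_iUnion_le _).trans_lt ?_)
  rw [tsum_fintype]
  exact ENNReal.sum_lt_top.2 fun i _ => measure_union_lt_top (hfin _ _) (hfin _ _)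

theorem int_of_cont (n : ℕ) (hn : 1 ≤ n) (r : ℝ) (hr : 0 < r) (f : EuclideanSpace ℝ (Fin n) → ℝ)
    (hf : ContinuousOn f {0}ᶜ) :
    IntegrableOn f (sphere 0 r) (μH[(n:ℝ) - 1]) := by
  have : IsFiniteMeasure ((μH[(n:ℝ) - 1] : Measure (EuclideanSpace ℝ (Fin n))).restrict (sphere 0 r)) :=
    ⟨by simpa using sphere_finite n hn r hr⟩
  have h2 : IntegrableOn f (sphere 0 r) ((μH[(n:ℝ) - 1] : Measure (EuclideanSpace ℝ (Fin n))).restrict (sphere 0 r)) := by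
    refine ContinuousOn.integrableOn_compact (isCompact_sphere _ _) (hf.mono ?_)
    intro x hx h
    simp at h hx
    subst h; simp at hx; linarith
  rwa [IntegrableOn, Measure.restrict_restrict isClosed_sphere.measurableSet, Set.inter_self] at h2

/-- infinitesimal rotation invariance -/
theorem int_rot (n : ℕ) (hn : 1 ≤ n) (r : ℝ) (hr : 0 < r) (f : EuclideanSpace ℝ (Fin n) → ℝ)
    (hf : ContDiffOn ℝ 1 f {0}ᶜ) (A : (EE n) →L[ℝ] (EE n)) (hA : A ∈ skewAdjoint ((EE n) →L[ℝ] (EE n))) :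
    ∫ x in sphere (0 : EE n) r, fderiv ℝ f x (A x) ∂(μH[(n:ℝ) - 1]) = 0 := by
  let U : ℝ → (EE n) →L[ℝ] (EE n) := fun t => NormedSpace.exp (t • A)
  have hU : ∀ t, U t ∈ unitary ((EE n) →L[ℝ] (EE n)) := fun t =>
    letI : NormedAlgebra ℚ ((EE n) →L[ℝ] (EE n)) := NormedAlgebra.restrictScalars ℚ ℝ _
    NormedSpace.exp_mem_unitary_of_mem_skewAdjoint (skewAdjoint.smul_mem t hA)
  have hU0 : ∀ x, U 0 x = x := fun x => by
    have h : (0:ℝ) • A = 0 := zero_smul ℝ A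
    have : U 0 = 1 := by simp only [U]; rw [h, NormedSpace.exp_zero]
    rw [this]; rfl
  have hUn : ∀ t x, ‖U t x‖ = ‖x‖ := fun t x => by
    exact (Unitary.linearIsometryEquiv ⟨U t, hU t⟩).norm_map x
  have hUd : ∀ t, HasDerivAt U (A * U t) t := fun t => hasDerivAt_exp_smul_const' A t
  have hinv : ∀ t, ∫ x in sphere (0 : EE n) r, f (U t x) ∂(μH[(n:ℝ) - 1]) =
      ∫ x in sphere (0 : EE n) r, f x ∂(μH[(n:ℝ) - 1]) := by
    intro t
    let e := (Unitary.linearIsometryEquiv ⟨U t, hU t⟩).toIsometryEquiv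
    have he : ∀ x, e x = U t x := fun x => rfl
    have h1 := (e.measurePreserving_hausdorffMeasure ((n:ℝ)-1)).setIntegral_preimage_emb
      e.toHomeomorph.measurableEmbedding f (sphere 0 r)
    have h2 : e ⁻¹' (sphere 0 r) = sphere 0 r := by
      ext x; rw [Set.mem_preimage, mem_sphere_zero_iff_norm, mem_sphere_zero_iff_norm, he, hUn]
    rw [h2] at h1
    exact h1
  have hO : IsOpen ({0}ᶜ : Set (EE n)) := isOpen_compl_singleton
  have hne : ∀ x ∈ sphere (0 : EE n) r, x ≠ 0 := by
    rintro x hx rfl; simp at hx; linarith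
  have hc1 : ContinuousOn (fun x => fderiv ℝ f x (A x)) {0}ᶜ :=
    (hf.continuousOn_fderiv_of_isOpen hO le_rfl).clm_apply A.continuous.continuousOn
  obtain ⟨C, hC⟩ := (isCompact_sphere (0 : EE n) r).exists_bound_of_continuousOn
    (hc1.mono (fun x hx => hne x hx))
  have hmeas := isClosed_sphere (x := (0 : EE n)) (ε := r) |>.measurableSet
  have key := hasDerivAt_integral_of_dominated_loc_of_deriv_le (𝕜 := ℝ)
    (μ := (μH[(n:ℝ) - 1] : Measure (EE n)).restrict (sphere 0 r))
    (F := fun t x => f (U t x)) (F' := fun t x => fderiv ℝ f (U t x) (A (U t x)))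
    (x₀ := 0) (s := Set.univ) (bound := fun _ => C) Filter.univ_mem ?_ ?_ ?_ ?_ ?_ ?_
  · have h1 := key.2
    simp only [hinv] at h1
    have h2 := h1.unique (hasDerivAt_const _ _)
    simpa only [hU0] using h2
  · refine Eventually.of_forall fun t => ?_
    refine (int_of_cont n hn r hr _ ?_).aestronglyMeasurable
    refine hf.continuousOn.comp (U t).continuous.continuousOn ?_
    intro x hx h
    apply hx
    simpa [hUn] using congrArg norm h
  · simp only [hU0]; exact int_of_cont n hn r hr f hf.continuousOn
  · simpa only [hU0] using (int_of_cont n hn r hr _ hc1).aestronglyMeasurable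
  · refine (ae_restrict_iff' hmeas).2 (Eventually.of_forall fun x hx t _ => ?_)
    exact hC _ (by simpa [hUn] using hx)
  · exact int_of_cont n hn r hr _ continuousOn_const
  · refine (ae_restrict_iff' hmeas).2 (Eventually.of_forall fun x hx t _ => ?_)
    have h3 : U t x ∈ ({0}ᶜ : Set (EE n)) := hne _ (by simpa [hUn] using hx)
    have h4 : HasFDerivAt f (fderiv ℝ f (U t x)) (U t x) :=
      ((hf.contDiffAt (hO.mem_nhds h3)).differentiableAt one_ne_zero).hasFDerivAt
    have h5 : HasDerivAt (fun t => U t x) (A (U t x)) t := by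
      simpa using (hUd t).clm_apply (hasDerivAt_const t x)
    exact h4.comp_hasDerivAt t h5

theorem scale (n : ℕ) (hn : 1 ≤ n) (r : ℝ) (hr : 0 < r) (f : EuclideanSpace ℝ (Fin n) → ℝ) (c : ℝ)
    (hf : ∀ x, f (r • x) = c * f x)
    (h0 : ∫ x in sphere (0 : EE n) 1, f x ∂(μH[(n:ℝ) - 1]) = 0) :
    ∫ x in sphere (0 : EE n) r, f x ∂(μH[(n:ℝ) - 1]) = 0 := by
  have hd : (0:ℝ) ≤ (n:ℝ) - 1 := by
    have : (1:ℝ) ≤ n := by exact_mod_cast hn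
    linarith
  let e := (Homeomorph.smulOfNeZero r hr.ne' : (EE n) ≃ₜ (EE n))
  have hmap : Measure.map e (μH[(n:ℝ) - 1]) = (‖r⁻¹‖₊ ^ ((n:ℝ)-1) : NNReal) • (μH[(n:ℝ) - 1] : Measure (EE n)) := by
    ext s hs
    rw [e.measurableEmbedding.map_apply, Measure.smul_apply]
    rw [← Measure.hausdorffMeasure_smul₀ hd (inv_ne_zero hr.ne')]
    congr 1
    exact Set.preimage_smul₀ hr.ne' s
  have h1 := e.measurableEmbedding.setIntegral_map (μ := μH[(n:ℝ) - 1]) f (sphere 0 r)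
  have h2 : e ⁻¹' (sphere 0 r) = sphere 0 1 := by
    ext x
    simp [e, norm_smul, abs_of_pos hr, hr.ne']
  rw [h2, hmap] at h1
  have h3 : ∀ x, f (e x) = c * f x := hf
  simp only [h3] at h1
  rw [integral_const_mul, h0, mul_zero, Measure.restrict_smul, integral_smul_nnreal_measure] at h1
  have h4 : (‖r⁻¹‖₊ ^ ((n:ℝ)-1) : NNReal) ≠ 0 := by
    have : 0 < ‖r⁻¹‖₊ := by simpa using hr.ne'
    exact (NNReal.rpow_pos this).ne'
  exact (smul_eq_zero.1 h1).resolve_left h4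

theorem homog_fderiv {E F : Type*} [NormedAddCommGroup E] [NormedSpace ℝ E]
    [NormedAddCommGroup F] [NormedSpace ℝ F] (f : E → F) (d : ℝ)
    (hh : ∀ t : ℝ, 0 < t → ∀ x : E, x ≠ 0 → f (t • x) = t ^ d • f x) :
    ∀ t : ℝ, 0 < t → ∀ x : E, x ≠ 0 → fderiv ℝ f (t • x) = t ^ (d - 1) • fderiv ℝ f x := by
  intro t ht x hx
  have h1 : (fun y => f (t • y)) =ᶠ[nhds x] fun y => t ^ d • f y := by
    filter_upwards [isOpen_compl_singleton.mem_nhds hx] with y hy using hh t ht y hy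
  have h2 := h1.fderiv_eq (𝕜 := ℝ)
  have h3 : fderiv ℝ (fun y => t ^ d • f y) x = t ^ d • fderiv ℝ f x :=
    congrFun (fderiv_const_smul_field (𝕜 := ℝ) (R := ℝ) (f := f) (t ^ d)) x
  rw [fderiv_comp_smul, h3] at h2
  rw [Real.rpow_sub_one ht.ne', div_eq_inv_mul, mul_smul, ← h2, smul_smul,
    inv_mul_cancel₀ ht.ne', one_smul]

theorem euler {E F : Type*} [NormedAddCommGroup E] [NormedSpace ℝ E]
    [NormedAddCommGroup F] [NormedSpace ℝ F] (f : E → F) (d : ℝ)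
    (hh : ∀ t : ℝ, 0 < t → ∀ x : E, x ≠ 0 → f (t • x) = t ^ d • f x)
    (x : E) (hx : x ≠ 0) (hf : DifferentiableAt ℝ f x) : fderiv ℝ f x x = d • f x := by
  have h1 : HasDerivAt (fun t : ℝ => f (t • x)) (fderiv ℝ f x x) 1 := by
    have h := (hasDerivAt_id (1:ℝ)).smul_const x
    have hf' : HasFDerivAt f (fderiv ℝ f x) ((1:ℝ) • x) := by
      rw [one_smul]; exact hf.hasFDerivAt
    have h3 := hf'.comp_hasDerivAt (1:ℝ) h
    rw [one_smul] at h3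
    exact h3
  have h2 : HasDerivAt (fun t : ℝ => t ^ d • f x) (d • f x) 1 := by
    simpa using (Real.hasDerivAt_rpow_const (x := 1) (p := d) (Or.inl one_ne_zero)).smul_const (f x)
  refine h1.unique (h2.congr_of_eventuallyEq ?_)
  filter_upwards [lt_mem_nhds (zero_lt_one' ℝ)] with t ht using hh t ht x hx

structure HH (n : ℕ) (d : ℝ) (f : EuclideanSpace ℝ (Fin n) → ℝ) : Prop where
  smooth : ContDiffOn ℝ ∞ f {0}ᶜ
  homog : ∀ t : ℝ, 0 < t → ∀ x, x ≠ 0 → f (t • x) = t ^ d • f x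

theorem lap_eq (n : ℕ) (f : EuclideanSpace ℝ (Fin n) → ℝ) (x : EE n) :
    lap n f x = -∑ i : Fin n, fderiv ℝ (fderiv ℝ f) x (EuclideanSpace.single i 1)
      (EuclideanSpace.single i 1) := by
  simp [lap, iteratedFDeriv_two_apply]

theorem HH.lap {n : ℕ} {d : ℝ} {f : EuclideanSpace ℝ (Fin n) → ℝ} (h : HH n d f) :
    HH n (d - 2) (lap n f) := by
  have hO : IsOpen ({0}ᶜ : Set (EE n)) := isOpen_compl_singleton
  constructor
  · have h1 : ContDiffOn ℝ ∞ (fderiv ℝ f) {0}ᶜ := h.smooth.fderiv_of_isOpen hO (by simp)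
    have h2 : ContDiffOn ℝ ∞ (fderiv ℝ (fderiv ℝ f)) {0}ᶜ := h1.fderiv_of_isOpen hO (by simp)
    have : _root_.lap n f = fun x => -∑ i : Fin n, fderiv ℝ (fderiv ℝ f) x (EuclideanSpace.single i 1)
      (EuclideanSpace.single i 1) := funext (lap_eq n f)
    rw [this]
    exact (ContDiffOn.sum fun i _ => (h2.clm_apply contDiffOn_const).clm_apply contDiffOn_const).neg
  · intro t ht x hx
    have := homog_fderiv (fderiv ℝ f) (d-1) (homog_fderiv f d h.homog) t ht x hx
    have e : d - 1 - 1 = d - 2 := by ring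
    rw [lap_eq, lap_eq, this, e]
    simp [Finset.mul_sum]

/-- the rotation generator `v ↦ v_i e_j - v_j e_i` -/
def gen (n : ℕ) (i j : Fin n) : (EE n) →L[ℝ] (EE n) :=
  (EuclideanSpace.proj i).smulRight (EuclideanSpace.single j (1:ℝ)) -
  (EuclideanSpace.proj j).smulRight (EuclideanSpace.single i (1:ℝ))

theorem gen_apply (n : ℕ) (i j : Fin n) (x : EE n) :
    gen n i j x = x i • EuclideanSpace.single j (1:ℝ) - x j • EuclideanSpace.single i (1:ℝ) := rfl

theorem gen_skew (n : ℕ) (i j : Fin n) : gen n i j ∈ skewAdjoint ((EE n) →L[ℝ] (EE n)) := by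
  rw [skewAdjoint.mem_iff, ContinuousLinearMap.star_eq_adjoint]
  symm
  rw [ContinuousLinearMap.eq_adjoint_iff]
  intro x y
  simp only [ContinuousLinearMap.neg_apply, gen_apply, inner_neg_left, inner_sub_left, inner_sub_right,
    inner_smul_left, inner_smul_right, EuclideanSpace.inner_single_left, EuclideanSpace.inner_single_right]
  simp
  ring

theorem step (n : ℕ) (hn : 1 ≤ n) (r : ℝ) (hr : 0 < r) {d : ℝ} {f : EuclideanSpace ℝ (Fin n) → ℝ}
    (h : HH n d f) (h0 : sInt n r f = 0) : sInt n r (lap n f) = 0 := by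
  have hO : IsOpen ({0}ᶜ : Set (EE n)) := isOpen_compl_singleton
  have h1 : ContDiffOn ℝ ∞ (fderiv ℝ f) {0}ᶜ := h.smooth.fderiv_of_isOpen hO (by simp)
  let e : Fin n → EE n := fun j => EuclideanSpace.single j (1:ℝ)
  let g : Fin n → Fin n → (EE n) → ℝ := fun i j x => x i * fderiv ℝ f x (e j)
  have hcoord : ∀ i : Fin n, ContDiff ℝ ∞ (fun x : EE n => x i) := fun i =>
    (EuclideanSpace.proj i : (EuclideanSpace ℝ (Fin n)) →L[ℝ] ℝ).contDiff
  have hg : ∀ i j, ContDiffOn ℝ ∞ (g i j) {0}ᶜ := fun i j =>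
    (hcoord i).contDiffOn.mul (h1.clm_apply contDiffOn_const)
  have hgi : ∀ i j, ∫ x in sphere (0 : EE n) r, fderiv ℝ (g i j) x (gen n i j x) ∂(μH[(n:ℝ) - 1]) = 0 :=
    fun i j => int_rot n hn r hr _ ((hg i j).of_le (by simp)) _ (gen_skew n i j)
  have hne : ∀ x ∈ sphere (0 : EE n) r, x ≠ 0 := by
    rintro x hx rfl; simp at hx; linarith
  have hint : ∀ i j, IntegrableOn (fun x => fderiv ℝ (g i j) x (gen n i j x)) (sphere (0 : EE n) r) (μH[(n:ℝ) - 1]) :=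
    fun i j => int_of_cont n hn r hr _
      (((hg i j).continuousOn_fderiv_of_isOpen hO (by simp)).clm_apply (gen n i j).continuous.continuousOn)
  have hsum : ∫ x in sphere (0 : EE n) r, ∑ i, ∑ j, fderiv ℝ (g i j) x (gen n i j x) ∂(μH[(n:ℝ) - 1]) = 0 := by
    rw [integral_finsetSum _ fun i _ => integrable_finsetSum _ fun j _ => hint i j]
    refine Finset.sum_eq_zero fun i _ => ?_
    rw [integral_finsetSum _ fun j _ => hint i j]
    exact Finset.sum_eq_zero fun j _ => hgi i j
  have hpt : ∀ x ∈ sphere (0 : EE n) r, lap n f x =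
      -(r^2)⁻¹ * (∑ i, ∑ j, fderiv ℝ (g i j) x (gen n i j x)) - (r^2)⁻¹ * (d * (d + n - 2)) * f x := by
    intro x hx
    have hx0 := hne x hx
    have hxr : ∑ i, x i ^ 2 = r ^ 2 := by
      rw [← EuclideanSpace.real_norm_sq_eq]; rw [mem_sphere_zero_iff_norm.1 hx]
    have hd1 : DifferentiableAt ℝ f x :=
      (h.smooth.contDiffAt (hO.mem_nhds hx0)).differentiableAt (by simp)
    have hd2 : DifferentiableAt ℝ (fderiv ℝ f) x :=
      (h1.contDiffAt (hO.mem_nhds hx0)).differentiableAt (by simp)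
    set D := fderiv ℝ f x with hD
    set H := fderiv ℝ (fderiv ℝ f) x with hH
    have e1 : D x = d * f x := euler f d h.homog x hx0 hd1
    have e2 : H x x = (d - 1) * (d * f x) := by
      have := euler (fderiv ℝ f) (d-1) (homog_fderiv f d h.homog) x hx0 hd2
      rw [← hH, ← hD] at this
      rw [this]; simp [e1]
    have hxe : x = ∑ i, x i • e i := by
      have := (EuclideanSpace.basisFun (Fin n) ℝ).sum_repr x
      simpa [e] using this.symm
    have hder : ∀ i j v, fderiv ℝ (g i j) x v = x i * H v (e j) + v i * D (e j) := by
      intro i j v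
      have a1 : HasFDerivAt (fun x : EE n => x i) (EuclideanSpace.proj i : (EuclideanSpace ℝ (Fin n)) →L[ℝ] ℝ) x :=
        (EuclideanSpace.proj i : (EuclideanSpace ℝ (Fin n)) →L[ℝ] ℝ).hasFDerivAt
      have a2 : HasFDerivAt (fun x => fderiv ℝ f x (e j)) (H.flip (e j)) x := by
        simpa using hd2.hasFDerivAt.clm_apply (hasFDerivAt_const (e j) x)
      have a3 := (a1.fun_mul a2).fderiv
      change fderiv ℝ (fun x => x i * fderiv ℝ f x (e j)) x v = _
      rw [a3]
      simp [hD, mul_comm]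
    have hD1 : ∑ j, x j * D (e j) = D x := by
      conv_rhs => rw [hxe]
      simp
    have hH1 : ∑ i, ∑ j, x i * (x j * H (e i) (e j)) = H x x := by
      have : ∀ v, H v x = ∑ j, x j * H v (e j) := by
        intro v; conv_lhs => rw [hxe]
        simp
      have h2 : ∀ v, H x v = ∑ i, x i * H (e i) v := by
        intro v
        have : H x = ∑ i, x i • H (e i) := by
          conv_lhs => rw [hxe]
          rw [map_sum]
          simp only [map_smul]
        rw [this]; simp
      rw [h2]
      simp only [this, Finset.mul_sum]
    have hterm : ∀ i j, fderiv ℝ (g i j) x (gen n i j x) =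
        x i ^ 2 * H (e j) (e j) - x i * (x j * H (e i) (e j)) +
         ((if i = j then x i * D (e j) else 0) - x j * D (e j)) := by
      intro i j
      rw [hder, gen_apply]
      simp [e, Pi.single_apply]
      split_ifs <;> ring
    have hG : ∑ i, ∑ j, fderiv ℝ (g i j) x (gen n i j x) =
        r^2 * (∑ j, H (e j) (e j)) - H x x + (D x - n * D x) := by
      simp only [hterm, Finset.sum_add_distrib, Finset.sum_sub_distrib, hH1, hD1]
      rw [← hxr, Finset.sum_mul_sum]
      simp [hD1]
    rw [hG, e1, e2, lap_eq]
    have : r ≠ 0 := hr.ne'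
    field_simp
    ring
  unfold sInt at *
  rw [setIntegral_congr_fun isClosed_sphere.measurableSet hpt, integral_sub, integral_const_mul,
    integral_const_mul, hsum, h0]
  · simp
  · exact Integrable.const_mul (integrable_finsetSum _ fun i _ => integrable_finsetSum _ fun j _ => hint i j) _
  · exact Integrable.const_mul (int_of_cont n hn r hr f h.smooth.continuousOn) _

theorem iter (n : ℕ) (hn : 1 ≤ n) (r : ℝ) (hr : 0 < r) (i : ℕ) : ∀ {d : ℝ} {f : EuclideanSpace ℝ (Fin n) → ℝ}
    (_ : HH n d f) (_ : sInt n r f = 0), sInt n r (lapIter n i f) = 0 ∧ sInt n r (xGrad n (lapIter n i f)) = 0 := by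
  induction i with
  | zero =>
    intro d f h h0
    refine ⟨h0, ?_⟩
    change sInt n r (xGrad n f) = 0
    unfold sInt at *
    have : ∀ x ∈ sphere (0 : EE n) r, xGrad n f x = d * f x := by
      intro x hx
      have hx0 : x ≠ 0 := by rintro rfl; simp at hx; linarith
      rw [← smul_eq_mul, ← euler f d h.homog x hx0 ((h.smooth.contDiffAt
        (isOpen_compl_singleton.mem_nhds hx0)).differentiableAt (by simp))]
      rw [xGrad, real_inner_comm, gradient, InnerProductSpace.toDual_symm_apply]
    rw [setIntegral_congr_fun isClosed_sphere.measurableSet this, integral_const_mul, h0, mul_zero]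
  | succ i ih =>
    intro d f h h0
    exact ih h.lap (step n hn r hr h h0)

/-- if `ψ` is a homogeneous polynomial of degree `m ≥ 1` with zero
mean on the unit sphere and `R₀(x) = |x|^{2k-n} ψ(x)`, then all the sphere integrals
`∫_{∂B(0,r)} Δ₀^i R₀ dσ` and `∫_{∂B(0,r)} ⟨x, ∇(Δ₀^i R₀)⟩ dσ` vanish. -/
theorem sphere_integrals_vanish (n k : ℕ) (hk : 1 ≤ k) (hn : 2*k < n)
    (m : ℕ) (hm : 1 ≤ m) (ψ : EuclideanSpace ℝ (Fin n) → ℝ)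
    (hψ : IsHomogPoly n m ψ) (hmean : sInt n 1 ψ = 0) :
    ∀ i : ℕ, ∀ r : ℝ, 0 < r →
      sInt n r (lapIter n i (fun x => ‖x‖ ^ (2*(k:ℝ) - n) * ψ x)) = 0
      ∧ sInt n r (xGrad n (lapIter n i (fun x => ‖x‖ ^ (2*(k:ℝ) - n) * ψ x))) = 0 := by
  intro i r hr
  have hn1 : 1 ≤ n := by omega
  obtain ⟨P, hP, hPe⟩ := hψ
  have hψs : ContDiff ℝ ∞ ψ := by
    have : ψ = fun x => MvPolynomial.aeval (fun i => x i) P := by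
      funext x; rw [hPe, MvPolynomial.aeval_def, MvPolynomial.eval]; rfl
    rw [this]
    have h := AnalyticOnNhd.aeval_mvPolynomial (𝕜 := ℝ) (s := Set.univ)
      (f := fun (x : EuclideanSpace ℝ (Fin n)) (i : Fin n) => x i) (fun i =>
      (EuclideanSpace.proj i : (EuclideanSpace ℝ (Fin n)) →L[ℝ] ℝ).analyticOnNhd _) P
    exact contDiffOn_univ.1 (h.contDiffOn uniqueDiffOn_univ)
  have hψh : ∀ (t : ℝ) x, ψ (t • x) = t ^ m * ψ x := by
    intro t x
    rw [hPe, hPe, MvPolynomial.eval_eq, MvPolynomial.eval_eq, Finset.mul_sum]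
    refine Finset.sum_congr rfl fun s hs => ?_
    have hs' := hP (MvPolynomial.mem_support_iff.1 hs)
    simp only [PiLp.smul_apply, smul_eq_mul, mul_pow, Finset.prod_mul_distrib, Finset.prod_pow_eq_pow_sum]
    have : ∑ i ∈ s.support, s i = m := by
      rw [← hs', Finsupp.weight_apply, Finsupp.sum]; simp
    rw [this]; ring
  refine iter n hn1 r hr i (d := 2*(k:ℝ) - n + m) ⟨?_, ?_⟩ ?_
  · refine ContDiffOn.mul ?_ hψs.contDiffOn
    intro x hx
    have hx : x ≠ 0 := hx
    exact ((contDiffAt_norm ℝ hx).rpow_const_of_ne (norm_ne_zero_iff.2 hx)).contDiffWithinAt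
  · intro t ht x hx
    rw [norm_smul, Real.norm_of_nonneg ht.le, Real.mul_rpow ht.le (norm_nonneg _), hψh,
      Real.rpow_add ht, Real.rpow_natCast, smul_eq_mul]
    ring
  · have h1 : sInt n r ψ = 0 := scale n hn1 r hr ψ _ (hψh r) hmean
    unfold sInt at *
    have : ∀ x ∈ sphere (0 : EuclideanSpace ℝ (Fin n)) r, ‖x‖ ^ (2*(k:ℝ) - n) * ψ x =
        r ^ (2*(k:ℝ) - n) * ψ x := by
      intro x hx; rw [mem_sphere_zero_iff_norm.1 hx]
    rw [setIntegral_congr_fun isClosed_sphere.measurableSet this, integral_const_mul, h1, mul_zero]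
end
end

section
/- Let n and k be integers with k ≥ 1 and n > 2k, and let U be the standard bubble. Then Δ₀^k U = U^{2*_k−1} on ℝⁿ, where 2*_k − 1 = (n+2k)/(n−2k). -/
open MeasureTheory Metric Filter
open scoped RealInnerProductSpace

noncomputable section

/-- The constant `𝔠_{n,k} = (∏_{j=-k}^{k-1} (n+2j))^{1/k}`. -/
def cnk (n k : ℕ) : ℝ :=
  (∏ j ∈ Finset.Icc (-(k:ℤ)) ((k:ℤ) - 1), ((n:ℝ) + 2*(j:ℝ))) ^ ((1:ℝ)/k)

/-- The standard bubble `U(x) = (1 + 𝔠_{n,k}⁻¹ |x|²)^{-(n-2k)/2}`. -/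
def bubble (n k : ℕ) (x : EuclideanSpace ℝ (Fin n)) : ℝ :=
  (1 + (cnk n k)⁻¹ * ‖x‖^2) ^ (-((n - 2*k : ℝ)/2))


def rf (x : ℝ) (m : ℕ) : ℝ := ∏ i ∈ Finset.range m, (x + i)

lemma rf_succ (x : ℝ) (m : ℕ) : rf x (m+1) = rf x m * (x + m) := by
  simp [rf, Finset.prod_range_succ]

lemma rf_succ' (x : ℝ) (m : ℕ) : rf x (m+1) = x * rf (x+1) m := by
  simp only [rf, Finset.prod_range_succ']
  rw [mul_comm]
  congr 1
  · simp
  · apply Finset.prod_congr rfl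
    intros; push_cast; ring

lemma rf_diff (t : ℝ) (j : ℕ) : rf (t+1) (j+1) - rf t (j+1) = (j+1) * rf (t+1) j := by
  rw [rf_succ, rf_succ' t]; ring

lemma shift_sum (m : ℕ) (t : ℝ) (X : ℕ → ℝ) :
    ∑ p ∈ Finset.HasAntidiagonal.antidiagonal m, (m.choose p.1 : ℝ) * (rf (t+1) p.2 - rf t p.2) * X (p.1+1)
    = ∑ p ∈ Finset.HasAntidiagonal.antidiagonal m, (m.choose p.1 : ℝ) * p.1 * rf (t+1) p.2 * X p.1 := by
  cases m with
  | zero => simp [rf]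
  | succ m =>
    rw [Finset.Nat.sum_antidiagonal_succ', Finset.Nat.sum_antidiagonal_succ]
    simp only [rf_diff]
    have h0 : ∀ x, rf x 0 = 1 := by intro x; simp [rf]
    simp only [h0, sub_self, mul_zero, zero_mul, zero_add, add_zero, Nat.cast_zero]
    apply Finset.sum_congr rfl
    rintro ⟨i, j⟩ hp
    have hij : i + j = m := by simpa using hp
    have h1 : ((m+1).choose (i+1) : ℝ) * ((i+1 : ℕ):ℝ) = (m+1).choose i * (j+1) := by
      have := Nat.choose_succ_right_eq (m+1) i
      have e : m + 1 - i = j + 1 := by omega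
      rw [e] at this
      exact_mod_cast this
    dsimp only
    rw [h1]; ring

lemma step_sum (m : ℕ) (t : ℝ) (X : ℕ → ℝ) :
    ∑ p ∈ Finset.HasAntidiagonal.antidiagonal m, (m.choose p.1 : ℝ) * rf (t+1) p.2 *
      ((t - p.1) * X p.1 + X (p.1+1))
    = ∑ p ∈ Finset.HasAntidiagonal.antidiagonal (m+1), ((m+1).choose p.1 : ℝ) * rf t p.2 * X p.1 := by
  have := Finset.sum_antidiagonal_choose_succ_mul (fun i j => rf t j * X i) m
  simp only [← mul_assoc] at this
  rw [this]
  have h2 : ∑ p ∈ Finset.HasAntidiagonal.antidiagonal m, (m.choose p.2 : ℝ) * rf t p.2 * X (p.1+1)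
    = ∑ p ∈ Finset.HasAntidiagonal.antidiagonal m, (m.choose p.1 : ℝ) * rf t p.2 * X (p.1+1) := by
    apply Finset.sum_congr rfl
    rintro ⟨i, j⟩ hp
    have hij : i + j = m := by simpa using hp
    dsimp only
    rw [Nat.choose_symm_of_eq_add hij.symm]
  rw [h2]
  have h3 := shift_sum m t X
  rw [← sub_eq_zero, ← Finset.sum_sub_distrib] at h3
  rw [← sub_eq_zero, ← Finset.sum_add_distrib, ← Finset.sum_sub_distrib, ← h3]
  apply Finset.sum_congr rfl
  intro p _
  rw [rf_succ']; ring

def WW (n : ℕ) (a s : ℝ) (x : EuclideanSpace ℝ (Fin n)) : ℝ := (1 + a * ‖x‖^2) ^ (-s)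

lemma ww_pos {n : ℕ} {a : ℝ} (ha : 0 ≤ a) (x : EuclideanSpace ℝ (Fin n)) :
    0 < 1 + a * ‖x‖^2 := by positivity

lemma ww_contDiff {n : ℕ} {a : ℝ} (ha : 0 ≤ a) (s : ℝ) : ContDiff ℝ 2 (WW n a s) := by
  unfold WW
  apply ContDiff.rpow_const_of_ne
  · exact contDiff_const.add (contDiff_const.mul (contDiff_norm_sq ℝ))
  · intro x; exact (ww_pos ha x).ne'

lemma ww_hasFDeriv {n : ℕ} {a : ℝ} (ha : 0 ≤ a) (s : ℝ) (x : EuclideanSpace ℝ (Fin n)) :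
    HasFDerivAt (WW n a s) ((-(2*a*s) * WW n a (s+1) x) • innerSL ℝ x) x := by
  have h1 : HasFDerivAt (fun x : EuclideanSpace ℝ (Fin n) => 1 + a * ‖x‖^2)
      (a • ((2:ℝ) • innerSL ℝ x)) x := by
    have := ((hasStrictFDerivAt_norm_sq x).hasFDerivAt.const_mul a).const_add 1
    rw [← Nat.cast_smul_eq_nsmul ℝ] at this
    exact_mod_cast this
  have h2 := h1.rpow_const (p := -s) (Or.inl (ww_pos ha x).ne')
  have h3 : ((-(2*a*s) * WW n a (s+1) x) • innerSL ℝ x)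
      = (-s * (1 + a * ‖x‖ ^ 2) ^ (-s - 1)) • a • (2:ℝ) • innerSL ℝ x := by
    rw [smul_smul, smul_smul]
    congr 1
    unfold WW
    rw [show -(s+1) = -s - 1 by ring]
    ring
  rw [h3]
  exact h2

lemma lap_ww {n : ℕ} {a : ℝ} (ha : 0 ≤ a) (s : ℝ) (x : EuclideanSpace ℝ (Fin n)) :
    lap n (WW n a s) x = 4 * a * (s * (((n:ℝ)/2 - 1 - s) * WW n a (s+1) x
      + (s+1) * WW n a (s+2) x)) := by
  unfold lap
  have hf : fderiv ℝ (WW n a s) = fun x => (-(2*a*s) * WW n a (s+1) x) • innerSL ℝ x := by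
    ext1 y; exact (ww_hasFDeriv ha s y).fderiv
  have key : ∀ i : Fin n, iteratedFDeriv ℝ 2 (WW n a s) x
      ![EuclideanSpace.single i (1:ℝ), EuclideanSpace.single i (1:ℝ)]
      = -(2*a*s) * WW n a (s+1) x + 4*a^2*s*(s+1) * WW n a (s+2) x * (x i)^2 := by
    intro i
    rw [iteratedFDeriv_two_apply, hf]
    have hg := (ww_hasFDeriv ha (s+1) x).const_mul (-(2*a*s))
    have hi : HasFDerivAt (fun y : EuclideanSpace ℝ (Fin n) => innerSL ℝ y) (innerSL ℝ) x :=
      (innerSL ℝ (E := EuclideanSpace ℝ (Fin n))).hasFDerivAt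
    rw [(hg.fun_smul hi).fderiv]
    simp [EuclideanSpace.inner_single_right, EuclideanSpace.inner_single_left]
    have hone : (innerSL ℝ (EuclideanSpace.single i (1:ℝ))) (EuclideanSpace.single i (1:ℝ))
        = (1:ℝ) := by
      rw [innerSL_apply_apply, EuclideanSpace.inner_single_left]; simp
    erw [hone]
    rw [show s + 1 + 1 = s + 2 by ring]
    ring
  simp only [key]
  rw [Finset.sum_add_distrib, ← Finset.mul_sum, ← Finset.mul_sum, ← EuclideanSpace.real_norm_sq_eq]
  simp only [Finset.sum_const, Finset.card_univ, Fintype.card_fin, nsmul_eq_mul]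
  have hw : WW n a (s+1) x = (1 + a * ‖x‖^2) * WW n a (s+2) x := by
    unfold WW
    rw [show -(s+1) = 1 + -(s+2) by ring, Real.rpow_add (ww_pos ha x), Real.rpow_one]
  rw [hw]; ring

lemma lap_sum {n : ℕ} {ι : Type*} (S : Finset ι) (c : ι → ℝ)
    (f : ι → EuclideanSpace ℝ (Fin n) → ℝ)
    (hf : ∀ i ∈ S, ContDiff ℝ 2 (f i)) (x : EuclideanSpace ℝ (Fin n)) :
    lap n (fun y => ∑ i ∈ S, c i * f i y) x = ∑ i ∈ S, c i * lap n (f i) x := by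
  unfold lap
  have h1 : iteratedFDeriv ℝ 2 (fun y => ∑ i ∈ S, c i * f i y) x
      = ∑ i ∈ S, c i • iteratedFDeriv ℝ 2 (f i) x := by
    rw [iteratedFDeriv_fun_sum_apply]
    · apply Finset.sum_congr rfl
      intro i hi
      exact iteratedFDeriv_const_smul_apply (a := c i) ((hf i hi).contDiffAt)
    · intro i hi
      exact (contDiff_const.mul (hf i hi)).contDiffAt
  rw [h1]
  simp only [_root_.sum_apply, _root_.smul_apply, smul_eq_mul]
  rw [Finset.sum_comm, ← Finset.sum_neg_distrib]
  apply Finset.sum_congr rfl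
  intro i _
  rw [← Finset.mul_sum]; ring

lemma lapIter_ww {n : ℕ} {a : ℝ} (ha : 0 ≤ a) (s : ℝ) (m : ℕ) :
    lapIter n m (WW n a s) = fun x => ∑ p ∈ Finset.HasAntidiagonal.antidiagonal m,
      ((4*a)^m * (m.choose p.1 : ℝ) * rf s (m+p.1) * rf ((n:ℝ)/2 - s - m) p.2)
        * WW n a (s+m+p.1) x := by
  induction m with
  | zero => ext x; simp [lapIter, rf]
  | succ m ih =>
    have : lapIter n (m+1) (WW n a s) = lap n (lapIter n m (WW n a s)) := by
      unfold lapIter; rw [Function.iterate_succ_apply']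
    rw [this, ih]
    ext x
    rw [lap_sum _ _ _ (fun i _ => ww_contDiff ha _)]
    have h := step_sum m ((n:ℝ)/2 - s - (m+1)) (fun i => rf s (m+1+i) * WW n a (s+m+1+i) x)
    have h' := congrArg (fun z => (4*a)^(m+1) * z) h
    simp only [Finset.mul_sum] at h'
    refine Eq.trans ?_ (h'.trans ?_)
    · apply Finset.sum_congr rfl
      rintro ⟨i, j⟩ _
      dsimp only
      rw [lap_ww ha, show m + 1 + (i+1) = (m + i + 1) + 1 by ring, rf_succ s (m+i+1),
        show m + 1 + i = (m + i) + 1 by ring, rf_succ s (m+i)]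
      push_cast
      rw [show (n:ℝ)/2 - s - (m+1) + 1 = (n:ℝ)/2 - s - m by ring,
        show s + m + i + 1 = s + m + 1 + i by ring,
        show s + m + 1 + (i+1) = s + m + i + 2 by ring]
      ring
    · apply Finset.sum_congr rfl
      rintro ⟨i, j⟩ _
      dsimp only
      push_cast
      rw [show s + (m + 1) + i = s + m + 1 + i by ring]
      ring

lemma prod_eq_rf (n k : ℕ) :
    ∏ j ∈ Finset.Icc (-(k:ℤ)) ((k:ℤ) - 1), ((n:ℝ) + 2*(j:ℝ))
      = 4^k * rf ((n:ℝ)/2 - k) (k+k) := by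
  have h : (4:ℝ)^k = ∏ i ∈ Finset.range (k+k), 2 := by
    rw [Finset.prod_const, Finset.card_range, ← two_mul, pow_mul]; norm_num
  rw [h, rf, ← Finset.prod_mul_distrib]
  symm
  apply Finset.prod_bij (fun (i : ℕ) _ => (i:ℤ) - k)
  · intro i hi; simp at hi ⊢; omega
  · intro i _ j _ h; simpa using h
  · intro b hb
    simp at hb
    refine ⟨(b + k).toNat, ?_, ?_⟩
    · simp; omega
    · omega
  · intro i _; push_cast; ring

/-- the standard bubble satisfies `Δ₀^k U = U^{2*_k - 1}` on `ℝⁿ`,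
where `2*_k − 1 = (n+2k)/(n−2k)`. -/
theorem bubble_equation (n k : ℕ) (hk : 1 ≤ k) (hn : 2*k < n) :
    ∀ x : EuclideanSpace ℝ (Fin n),
      lapIter n k (bubble n k) x = bubble n k x ^ (((n:ℝ) + 2*k)/((n:ℝ) - 2*k)) := by
  intro x
  have hnk : (2*k:ℝ) < n := by exact_mod_cast hn
  have hs : 0 < (n:ℝ)/2 - k := by linarith
  have hR : 0 < rf ((n:ℝ)/2 - k) (k+k) := by
    unfold rf; exact Finset.prod_pos (fun i _ => by positivity)
  have hc : 0 < cnk n k := by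
    unfold cnk; rw [prod_eq_rf]; positivity
  have hck : (cnk n k)^k = 4^k * rf ((n:ℝ)/2 - k) (k+k) := by
    unfold cnk; rw [prod_eq_rf, one_div]
    exact Real.rpow_inv_natCast_pow (by positivity) (by omega)
  have ha : 0 ≤ (cnk n k)⁻¹ := by positivity
  have hb : bubble n k = WW n (cnk n k)⁻¹ ((n:ℝ)/2 - k) := by
    ext y; unfold bubble WW; congr 1; ring
  rw [hb, lapIter_ww ha]
  dsimp only
  rw [Finset.sum_eq_single (k, 0)]
  · have e : (4 * (cnk n k)⁻¹)^k * rf ((n:ℝ)/2 - k) (k+k) = 1 := by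
      rw [mul_pow, inv_pow, mul_right_comm, ← hck]
      exact mul_inv_cancel₀ (by positivity)
    have e0 : ∀ y, rf y 0 = 1 := by intro y; simp [rf]
    dsimp only
    rw [e0, Nat.choose_self, Nat.cast_one, mul_one, mul_one, e, one_mul]
    unfold WW
    rw [← Real.rpow_mul (ww_pos ha x).le]
    congr 1
    have : (n:ℝ) - 2*k ≠ 0 := by linarith
    field_simp
    ring
  · rintro ⟨i, j⟩ hp hne
    have hij : i + j = k := by simpa using hp
    have hj : j ≠ 0 := by rintro rfl; apply hne; simp at hij; simp [hij]
    obtain ⟨j, rfl⟩ := Nat.exists_eq_succ_of_ne_zero hj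
    dsimp only
    rw [Nat.succ_eq_add_one, rf_succ', show (n:ℝ)/2 - ((n:ℝ)/2 - k) - k = 0 by ring]
    ring
  · intro h; simp at h
end
end
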